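/- Let σ = (T, W^−, W, W^+) be a divided stopping time and S a Λ-stopping time with σ ≥ S, meaning T ≥ S and T > S on W^−. Then for every nonnegative Λ-martingale M : Ω × [0,∞] → ℝ one has M_S = E[M_σ | F^Λ_S], and for every nonnegative Λ-supermartingale Z : Ω × [0,∞] → ℝ one has Z_S ≥ E[Z_σ | F^Λ_S]. -/

import Mathlib

open MeasureTheory Filter Set Topology
open scoped NNReal ENNReal symmDiff Classical

noncomputable section

namespace Meyer

variable {Ω : Type*}

/-- The σ-field generated by a family of real-valued functions. -/
def genBy {α : Type*} (C : Set (α → ℝ)) : MeasurableSpace α :=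
  ⨆ f ∈ C, MeasurableSpace.comap f inferInstance

/-- A function is càdlàg: right-continuous with left limits. -/
def IsCadlag (f : ℝ≥0 → ℝ) : Prop :=
  (∀ t, Tendsto f (𝓝[≥] t) (𝓝 (f t))) ∧
  ∀ t : ℝ≥0, 0 < t → ∃ l, Tendsto f (𝓝[<] t) (𝓝 l)

/-- A Meyer-σ-field over `(Ω, mΩ)`: a σ-field on `Ω × [0,∞)` contained in the product
σ-field, generated by càdlàg processes, containing `{∅,Ω} × B([0,∞))` and stable under
stopping at deterministic times. -/
structure IsMeyer (mΩ : MeasurableSpace Ω) (Λ : MeasurableSpace (Ω × ℝ≥0)) : Prop where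
  le_prod : Λ ≤ @Prod.instMeasurableSpace Ω ℝ≥0 mΩ inferInstance
  gen_cadlag : ∃ C : Set (Ω × ℝ≥0 → ℝ),
    (∀ Z ∈ C, ∀ ω, IsCadlag fun t => Z (ω, t)) ∧ Λ = genBy C
  contains_borel : ∀ B : Set ℝ≥0, MeasurableSet B → MeasurableSet[Λ] (Set.univ ×ˢ B)
  stop_stable : ∀ Z : Ω × ℝ≥0 → ℝ, Measurable[Λ] Z → ∀ s : ℝ≥0,
    Measurable[Λ] fun p => Z (p.1, min p.2 s)

/-- A `Λ`-stopping time: `[[S,∞[[ ∈ Λ`. -/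
def IsStoppingTimeM (Λ : MeasurableSpace (Ω × ℝ≥0)) (S : Ω → ℝ≥0∞) : Prop :=
  MeasurableSet[Λ] {p : Ω × ℝ≥0 | S p.1 ≤ (p.2 : ℝ≥0∞)}

/-- The associated filtration `F^Λ_t := σ(Z_t : Z Λ-measurable)`. -/
def sigmaAt (Λ : MeasurableSpace (Ω × ℝ≥0)) (t : ℝ≥0) : MeasurableSpace Ω :=
  genBy {f : Ω → ℝ | ∃ Z : Ω × ℝ≥0 → ℝ, Measurable[Λ] Z ∧ f = fun ω => Z (ω, t)}

/-- `F^Λ_∞`. -/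
def sigmaInf (Λ : MeasurableSpace (Ω × ℝ≥0)) : MeasurableSpace Ω := ⨆ t : ℝ≥0, sigmaAt Λ t

/-- A process indexed by `[0,∞]` is `Λ`-measurable if its restriction to `Ω × [0,∞)`
is `Λ`-measurable and its value at `∞` is `F^Λ_∞`-measurable. -/
def MeasurableProcessE (Λ : MeasurableSpace (Ω × ℝ≥0)) (Z : Ω × ℝ≥0∞ → ℝ) : Prop :=
  Measurable[Λ] (fun p : Ω × ℝ≥0 => Z (p.1, (p.2 : ℝ≥0∞))) ∧
  Measurable[sigmaInf Λ] fun ω => Z (ω, ∞)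

/-- `F^Λ_S := σ(Z_S : Z a Λ-measurable process on [0,∞])`. -/
def sigmaAtTime (Λ : MeasurableSpace (Ω × ℝ≥0)) (S : Ω → ℝ≥0∞) : MeasurableSpace Ω :=
  genBy {f : Ω → ℝ | ∃ Z : Ω × ℝ≥0∞ → ℝ, MeasurableProcessE Λ Z ∧ f = fun ω => Z (ω, S ω)}

/-- `S_A`: equal to `S` on `A` and `∞` off `A`. -/
def restrictST (S : Ω → ℝ≥0∞) (A : Set Ω) : Ω → ℝ≥0∞ := fun ω => if ω ∈ A then S ω else ∞

/-- Evaluation of a process indexed by `[0,∞]` at a random time. -/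
def EvalAt (Z : Ω × ℝ≥0∞ → ℝ) (S : Ω → ℝ≥0∞) : Ω → ℝ := fun ω => Z (ω, S ω)

/-- Evaluation of a process indexed by `[0,∞)` at a (finite) random time. -/
def EvalAtF (Z : Ω × ℝ≥0 → ℝ) (S : Ω → ℝ≥0∞) : Ω → ℝ := fun ω => Z (ω, (S ω).toNNReal)

/-- Adaptedness of a process to a raw filtration. -/
def Adapted' (G : ℝ≥0 → MeasurableSpace Ω) (Z : Ω × ℝ≥0 → ℝ) : Prop :=
  ∀ t, Measurable[G t] fun ω => Z (ω, t)

/-- Predictable σ-field of a filtration: generated by continuous adapted processes. -/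
def predSF (G : ℝ≥0 → MeasurableSpace Ω) : MeasurableSpace (Ω × ℝ≥0) :=
  genBy {Z | (∀ ω, Continuous fun t => Z (ω, t)) ∧ Adapted' G Z}

/-- Optional σ-field of a filtration: generated by càdlàg adapted processes. -/
def optSF (G : ℝ≥0 → MeasurableSpace Ω) : MeasurableSpace (Ω × ℝ≥0) :=
  genBy {Z | (∀ ω, IsCadlag fun t => Z (ω, t)) ∧ Adapted' G Z}

/-- Classical stopping time of a raw filtration. -/
def IsStoppingTimeCl (G : ℝ≥0 → MeasurableSpace Ω) (T : Ω → ℝ≥0∞) : Prop :=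
  ∀ t : ℝ≥0, MeasurableSet[G t] {ω | T ω ≤ (t : ℝ≥0∞)}

/-- The right-continuous filtration `F^Λ_{t+}`. -/
def FplusLambda (Λ : MeasurableSpace (Ω × ℝ≥0)) (t : ℝ≥0) : MeasurableSpace Ω :=
  ⨅ (s : ℝ≥0) (_ : t < s), sigmaAt Λ s

/-- Two processes are indistinguishable. -/
def Indistinguishable {τ : Type*} [MeasurableSpace Ω] (P : Measure Ω)
    (X Y : Ω × τ → ℝ) : Prop :=
  P {ω | ∃ t, X (ω, t) ≠ Y (ω, t)} = 0

/-- `Λ` is `P`-complete: every product-measurable process indistinguishable from a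
`Λ`-measurable process is itself `Λ`-measurable. -/
def IsPCompleteM [mΩ : MeasurableSpace Ω] (P : Measure Ω)
    (Λ : MeasurableSpace (Ω × ℝ≥0)) : Prop :=
  ∀ Z Z' : Ω × ℝ≥0 → ℝ, Measurable Z → Measurable[Λ] Z' →
    Indistinguishable P Z Z' → Measurable[Λ] Z

/-- A raw filtration satisfies the usual conditions: monotone, sub-σ-fields of `mΩ`,
right-continuous and `P`-complete. -/
def UsualConditions [mΩ : MeasurableSpace Ω] (P : Measure Ω)
    (G : ℝ≥0 → MeasurableSpace Ω) : Prop :=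
  Monotone G ∧ (∀ t, G t ≤ mΩ) ∧
  (∀ t : ℝ≥0, G t = ⨅ (s : ℝ≥0) (_ : t < s), G s) ∧
  ∀ N : Set Ω, MeasurableSet N → P N = 0 → MeasurableSet[G 0] N

variable [mΩ : MeasurableSpace Ω]

/-- `Λ`-martingale (indexed by `[0,∞]`). -/
def IsMartingaleM (P : Measure Ω) (Λ : MeasurableSpace (Ω × ℝ≥0))
    (Z : Ω × ℝ≥0∞ → ℝ) : Prop :=
  MeasurableProcessE Λ Z ∧
  (∀ S, IsStoppingTimeM Λ S → Integrable (EvalAt Z S) P) ∧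
  ∀ S T : Ω → ℝ≥0∞, IsStoppingTimeM Λ S → IsStoppingTimeM Λ T → S ≤ T →
    EvalAt Z S =ᵐ[P] P[EvalAt Z T|sigmaAtTime Λ S]

/-- `Λ`-supermartingale (indexed by `[0,∞]`). -/
def IsSupermartingaleM (P : Measure Ω) (Λ : MeasurableSpace (Ω × ℝ≥0))
    (Z : Ω × ℝ≥0∞ → ℝ) : Prop :=
  MeasurableProcessE Λ Z ∧
  (∀ S, IsStoppingTimeM Λ S → Integrable (EvalAt Z S) P) ∧
  ∀ S T : Ω → ℝ≥0∞, IsStoppingTimeM Λ S → IsStoppingTimeM Λ T → S ≤ T →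
    P[EvalAt Z T|sigmaAtTime Λ S] ≤ᵐ[P] EvalAt Z S

/-- Class `(D^Λ)` for a process: uniform integrability of `{Z_T : T ∈ S^Λ}`. -/
def ClassD (P : Measure Ω) (Λ : MeasurableSpace (Ω × ℝ≥0)) (Z : Ω × ℝ≥0∞ → ℝ) : Prop :=
  UniformIntegrable (fun S : {S : Ω → ℝ≥0∞ // IsStoppingTimeM Λ S} => EvalAt Z S.1) 1 P

/-- Class `(D^Λ)` for a system. -/
def ClassDSys (P : Measure Ω) (Λ : MeasurableSpace (Ω × ℝ≥0))
    (ZS : (Ω → ℝ≥0∞) → Ω → ℝ) : Prop :=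
  UniformIntegrable (fun S : {S : Ω → ℝ≥0∞ // IsStoppingTimeM Λ S} => ZS S.1) 1 P

/-- `pY` is a `Λ`-projection of `Y` (processes indexed by `[0,∞]`). -/
def IsProjectionE (P : Measure Ω) (Λ : MeasurableSpace (Ω × ℝ≥0))
    (Y pY : Ω × ℝ≥0∞ → ℝ) : Prop :=
  MeasurableProcessE Λ pY ∧
  ∀ S, IsStoppingTimeM Λ S → (∀ ω, S ω < ∞) →
    EvalAt pY S =ᵐ[P] P[EvalAt Y S|sigmaAtTime Λ S]

/-- `pY` is a `Λ`-projection of `Y` (processes indexed by `[0,∞)`). -/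
def IsProjectionF (P : Measure Ω) (Λ : MeasurableSpace (Ω × ℝ≥0))
    (Y pY : Ω × ℝ≥0 → ℝ) : Prop :=
  Measurable[Λ] pY ∧
  ∀ S, IsStoppingTimeM Λ S → (∀ ω, S ω < ∞) →
    EvalAtF pY S =ᵐ[P] P[EvalAtF Y S|sigmaAtTime Λ S]

/-- Right-upper-semicontinuous envelope `Z^*` (with `Z^*_∞ := Z_∞`). -/
def rightLimsup (Z : Ω × ℝ≥0∞ → ℝ) (ω : Ω) (t : ℝ≥0∞) : ℝ :=
  if t = ∞ then Z (ω, ∞)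
  else limsup (fun s : ℝ≥0 => Z (ω, (s : ℝ≥0∞))) (𝓝[>] t.toNNReal)

/-- Right-lower-semicontinuous envelope `Z_*` (with `Z_{∞*} := Z_∞`). -/
def rightLiminf (Z : Ω × ℝ≥0∞ → ℝ) (ω : Ω) (t : ℝ≥0∞) : ℝ :=
  if t = ∞ then Z (ω, ∞)
  else liminf (fun s : ℝ≥0 => Z (ω, (s : ℝ≥0∞))) (𝓝[>] t.toNNReal)

/-- Left-upper-semicontinuous envelope `*Z` (with `*Z_0 := Z_0` and
`*Z_∞ := limsup_{t↑∞} Z_t`). -/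
def leftLimsup (Z : Ω × ℝ≥0∞ → ℝ) (ω : Ω) (t : ℝ≥0∞) : ℝ :=
  if t = 0 then Z (ω, 0)
  else if t = ∞ then limsup (fun s : ℝ≥0 => Z (ω, (s : ℝ≥0∞))) atTop
  else limsup (fun s : ℝ≥0 => Z (ω, (s : ℝ≥0∞))) (𝓝[<] t.toNNReal)

/-- Left-lower-semicontinuous envelope `_*Z`. -/
def leftLiminf (Z : Ω × ℝ≥0∞ → ℝ) (ω : Ω) (t : ℝ≥0∞) : ℝ :=
  if t = 0 then Z (ω, 0)
  else if t = ∞ then liminf (fun s : ℝ≥0 => Z (ω, (s : ℝ≥0∞))) atTop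
  else liminf (fun s : ℝ≥0 => Z (ω, (s : ℝ≥0∞))) (𝓝[<] t.toNNReal)

/-- `T` is `Λ`-accessible. -/
def IsAccessibleM [mΩ2 : MeasurableSpace Ω] (P : Measure Ω)
    (Λ : MeasurableSpace (Ω × ℝ≥0)) (T : Ω → ℝ≥0∞) : Prop :=
  ∃ Tn : ℕ → Ω → ℝ≥0∞, (∀ n, IsStoppingTimeM Λ (Tn n)) ∧
    P (⋃ n, {ω | Tn n ω = T ω ∧ T ω < ∞}) = P {ω | T ω < ∞}

/-- `T` is totally `Λ`-inaccessible. -/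
def IsTotallyInaccessibleM [mΩ2 : MeasurableSpace Ω] (P : Measure Ω)
    (Λ : MeasurableSpace (Ω × ℝ≥0)) (T : Ω → ℝ≥0∞) : Prop :=
  ∀ S, IsStoppingTimeM Λ S → P {ω | S ω = T ω ∧ T ω < ∞} = 0

/-- The σ-field `G_{T-}`: generated by `G_0` and the sets `A ∩ {t < T}`, `A ∈ G_t`. -/
def sigmaPre (G : ℝ≥0 → MeasurableSpace Ω) (T : Ω → ℝ≥0∞) : MeasurableSpace Ω :=
  MeasurableSpace.generateFrom
    ({A | MeasurableSet[G 0] A} ∪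
      {A | ∃ (t : ℝ≥0) (B : Set Ω), MeasurableSet[G t] B ∧ A = B ∩ {ω | (t : ℝ≥0∞) < T ω}})

/-- The σ-field `G_T` of a classical stopping time `T`. -/
def sigmaAtCl (G : ℝ≥0 → MeasurableSpace Ω) (T : Ω → ℝ≥0∞) : MeasurableSpace Ω :=
  MeasurableSpace.generateFrom
    {A | ∀ t : ℝ≥0, MeasurableSet[G t] (A ∩ {ω | T ω ≤ (t : ℝ≥0∞)})}

/-- A divided stopping time `σ = (T, W⁻, W, W⁺)`. -/
structure IsDividedST (Λ : MeasurableSpace (Ω × ℝ≥0)) (T : Ω → ℝ≥0∞)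
    (Wm W Wp : Set Ω) : Prop where
  stopping : IsStoppingTimeCl (FplusLambda Λ) T
  cover : Wm ∪ W ∪ Wp = Set.univ
  disj_mw : Wm ∩ W = ∅
  disj_mp : Wm ∩ Wp = ∅
  disj_wp : W ∩ Wp = ∅
  mem_m : MeasurableSet[sigmaPre (FplusLambda Λ) T] Wm
  m_pos : Wm ∩ {ω | T ω = 0} = ∅
  mem_w : MeasurableSet[sigmaAtTime Λ T] W
  mem_p : MeasurableSet[sigmaAtCl (FplusLambda Λ) T] Wp
  p_fin : Wp ∩ {ω | T ω = ∞} = ∅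
  pred_m : IsStoppingTimeM (predSF (FplusLambda Λ)) (restrictST T Wm)
  st_w : IsStoppingTimeM Λ (restrictST T W)

/-- The value `Z_σ` of a process at a divided stopping time. -/
def divEval (Z : Ω × ℝ≥0∞ → ℝ) (T : Ω → ℝ≥0∞) (Wm W Wp : Set Ω) : Ω → ℝ := fun ω =>
  if ω ∈ Wm then leftLimsup Z ω (T ω)
  else if ω ∈ W then Z (ω, T ω)
  else rightLimsup Z ω (T ω)

/-- `Zb` is the `Λ`-Snell envelope of the system `ZS`: a `Λ`-supermartingale which at
each `Λ`-stopping time `S` is (a version of) `ess sup_{T ∈ S^Λ, T ≥ S} E[Z(T) | F^Λ_S]`. -/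
def IsSnellSys (P : Measure Ω) (Λ : MeasurableSpace (Ω × ℝ≥0))
    (ZS : (Ω → ℝ≥0∞) → Ω → ℝ) (Zb : Ω × ℝ≥0∞ → ℝ) : Prop :=
  IsSupermartingaleM P Λ Zb ∧
  ∀ S, IsStoppingTimeM Λ S →
    (∀ T, IsStoppingTimeM Λ T → S ≤ T →
      P[ZS T|sigmaAtTime Λ S] ≤ᵐ[P] EvalAt Zb S) ∧
    ∀ U : Ω → ℝ,
      (∀ T, IsStoppingTimeM Λ T → S ≤ T → P[ZS T|sigmaAtTime Λ S] ≤ᵐ[P] U) →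
      EvalAt Zb S ≤ᵐ[P] U

/-- `Zb` is the `Λ`-Snell envelope of the process `Z`. -/
def IsSnellProc (P : Measure Ω) (Λ : MeasurableSpace (Ω × ℝ≥0))
    (Z Zb : Ω × ℝ≥0∞ → ℝ) : Prop :=
  IsSnellSys P Λ (fun S => EvalAt Z S) Zb

/-- An `S^Λ`-system. -/
def IsSystemM (P : Measure Ω) (Λ : MeasurableSpace (Ω × ℝ≥0))
    (ZS : (Ω → ℝ≥0∞) → Ω → ℝ) : Prop :=
  (∀ S T, IsStoppingTimeM Λ S → IsStoppingTimeM Λ T →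
    ∀ᵐ ω ∂P, S ω = T ω → ZS S ω = ZS T ω) ∧
  ∀ S, IsStoppingTimeM Λ S → Measurable[sigmaAtTime Λ S] (ZS S)

/-- An `S^Λ`-supermartingale system. -/
def IsSupermartingaleSystem (P : Measure Ω) (Λ : MeasurableSpace (Ω × ℝ≥0))
    (ZS : (Ω → ℝ≥0∞) → Ω → ℝ) : Prop :=
  IsSystemM P Λ ZS ∧ (∀ S, IsStoppingTimeM Λ S → Integrable (ZS S) P) ∧
  ∀ S T, IsStoppingTimeM Λ S → IsStoppingTimeM Λ T → S ≤ T →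
    P[ZS T|sigmaAtTime Λ S] ≤ᵐ[P] ZS S

/-- The process `Zb` aggregates the system `ZS`. -/
def Aggregates (P : Measure Ω) (Λ : MeasurableSpace (Ω × ℝ≥0))
    (Zb : Ω × ℝ≥0∞ → ℝ) (ZS : (Ω → ℝ≥0∞) → Ω → ℝ) : Prop :=
  ∀ S, IsStoppingTimeM Λ S → EvalAt Zb S =ᵐ[P] ZS S

/-- `pY` is the `F`-predictable projection of `Y` (with the convention `(^P Y)_∞ = 0`). -/
def IsPredProjE (P : Measure Ω) (G : ℝ≥0 → MeasurableSpace Ω)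
    (Y pY : Ω × ℝ≥0∞ → ℝ) : Prop :=
  MeasurableProcessE (predSF G) pY ∧ (∀ ω, pY (ω, ∞) = 0) ∧
  ∀ S, IsStoppingTimeM (predSF G) S → (∀ ω, S ω < ∞) →
    EvalAt pY S =ᵐ[P] P[EvalAt Y S|sigmaAtTime (predSF G) S]


set_option linter.unusedSectionVars false
set_option linter.unusedSimpArgs false

/-! ### Capacity and projection -/

theorem capacity_aux {X : Type*} [TopologicalSpace X] [MeasurableSpace X]
    (ν : Measure X) [ν.OuterRegular] (g : (ℕ → ℕ) → X) (hg : Continuous g) (c : ℝ≥0∞)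
    (hc : c < ν (range g)) :
    ∃ N : ℕ → ℕ, c ≤ ν (g '' {x | ∀ i, x i ≤ N i}) := by
  -- sets constrained by a finite list
  let s : (ℕ → ℕ) → ℕ → Set (ℕ → ℕ) := fun N k => {x | ∀ i < k, x i ≤ N i}
  have step : ∀ (N : ℕ → ℕ) (k : ℕ), c < ν (g '' s N k) →
      ∃ m : ℕ, c < ν (g '' (s N k ∩ {x | x k ≤ m})) := by
    intro N k h
    have hU : g '' s N k = ⋃ m : ℕ, g '' (s N k ∩ {x | x k ≤ m}) := by
      rw [← image_iUnion, ← inter_iUnion]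
      congr 1
      ext x
      simp only [mem_inter_iff, mem_iUnion, mem_ofPred_eq]
      exact ⟨fun h => ⟨h, x k, le_rfl⟩, fun h => h.1⟩
    have hmono : Monotone fun m : ℕ => g '' (s N k ∩ {x | x k ≤ m}) := by
      intro a b hab
      apply image_mono
      rintro x ⟨h1, h2⟩
      exact ⟨h1, le_trans h2 hab⟩
    rw [hU, hmono.measure_iUnion] at h
    exact lt_iSup_iff.1 h
  -- recursive construction: at stage k, N agrees so far
  let St := {p : ℕ × (ℕ → ℕ) // c < ν (g '' s p.2 p.1)}
  have nxt : ∀ p : St, ∃ q : St, q.1.1 = p.1.1 + 1 ∧ ∀ i < p.1.1, q.1.2 i = p.1.2 i := by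
    rintro ⟨⟨k, N⟩, h⟩
    obtain ⟨m, hm⟩ := step N k h
    refine ⟨⟨⟨k + 1, Function.update N k m⟩, ?_⟩, rfl, ?_⟩
    · convert hm using 3
      ext x
      simp only [s, mem_ofPred_eq, mem_inter_iff]
      constructor
      · intro h
        refine ⟨fun i hi => ?_, ?_⟩
        · have := h i (by omega)
          rwa [Function.update_of_ne (by omega)] at this
        · simpa using h k (by omega)
      · rintro ⟨h1, h2⟩ i hi
        rcases eq_or_ne i k with rfl | hne
        · simpa using h2
        · rw [Function.update_of_ne hne]; exact h1 i (by omega)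
    · intro i hi
      exact Function.update_of_ne (by simp at hi; omega) _ _
  choose nx hnx1 hnx2 using nxt
  let p0 : St := ⟨⟨0, fun _ => 0⟩, by
    have : s (fun _ => 0) 0 = univ := by ext x; simp [s]
    simpa [this, image_univ] using hc⟩
  let q : ℕ → St := fun n => Nat.rec p0 (fun _ p => nx p) n
  have hq1 : ∀ n, (q n).1.1 = n := by
    intro n
    induction n with
    | zero => rfl
    | succ n ih => rw [show q (n+1) = nx (q n) from rfl, hnx1, ih]
  have hq2 : ∀ n i, i < n → (q (n+1)).1.2 i = (q n).1.2 i := by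
    intro n i hi
    exact hnx2 (q n) i (by rw [hq1]; exact hi)
  let N : ℕ → ℕ := fun i => (q (i+1)).1.2 i
  have hN : ∀ n i, i < n → (q n).1.2 i = N i := by
    intro n
    induction n with
    | zero => intro i hi; omega
    | succ n ih =>
      intro i hi
      rcases eq_or_ne i n with rfl | hne
      · rfl
      · rw [hq2 n i (by omega), ih i (by omega)]
  have hsN : ∀ k, c < ν (g '' s N k) := by
    intro k
    have h := (q k).2
    rw [hq1] at h
    convert h using 3
    ext x
    simp only [s, mem_ofPred_eq]
    constructor
    · intro h i hi; rw [hN k i hi]; exact h i hi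
    · intro h i hi; rw [← hN k i hi]; exact h i hi
  refine ⟨N, ?_⟩
  by_contra hlt
  push Not at hlt
  obtain ⟨U, hKU, hUo, hUc⟩ := Set.exists_isOpen_lt_of_lt _ _ hlt
  have hex : ∀ k, ∃ x ∈ s N k, g x ∉ U := by
    intro k
    by_contra hcon
    push Not at hcon
    have : g '' s N k ⊆ U := by rintro _ ⟨x, hx, rfl⟩; exact hcon x hx
    exact absurd (hsN k) (not_lt.2 ((measure_mono this).trans hUc.le))
  choose x hx hxU using hex
  have hK : IsCompact {x : ℕ → ℕ | ∀ i, x i ≤ N i} := by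
    have : {x : ℕ → ℕ | ∀ i, x i ≤ N i} = Set.univ.pi fun i => Set.Iic (N i) := by
      ext x; simp only [mem_ofPred_eq, Set.mem_univ_pi, mem_Iic]
    rw [this]
    exact isCompact_univ_pi fun i => (Set.finite_Iic (N i)).isCompact
  obtain ⟨y, hy, φ, hφ, hlim⟩ := hK.tendsto_subseq (x := fun k i => min (x k i) (N i))
    (fun k i => min_le_right _ _)
  have hlim2 : Tendsto (x ∘ φ) atTop (𝓝 y) := by
    rw [tendsto_pi_nhds] at hlim ⊢
    intro i
    refine (hlim i).congr' ?_
    filter_upwards [eventually_gt_atTop i] with k hk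
    have : i < φ k := lt_of_lt_of_le hk hφ.le_apply
    simp only [Function.comp]
    exact min_eq_left (hx (φ k) i this)
  have hgy : g y ∈ U := hKU ⟨y, hy, rfl⟩
  have := (hg.tendsto y).comp hlim2
  obtain ⟨k, hk⟩ := (this.eventually (hUo.mem_nhds hgy)).exists
  exact hxU (φ k) hk

theorem capacity {X : Type*} [TopologicalSpace X] [PolishSpace X] [MeasurableSpace X] [BorelSpace X]
    (ν : Measure X) [IsFiniteMeasure ν] (E : Set (X × ℝ≥0)) (hE : MeasurableSet E) (c : ℝ≥0∞)
    (hc : c < ν (Prod.fst '' E)) :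
    ∃ K ⊆ E, IsCompact K ∧ c ≤ ν (Prod.fst '' K) := by
  have ha := hE.analyticSet
  rw [AnalyticSet] at ha
  rcases ha with rfl | ⟨f, hf, rfl⟩
  · simp at hc
  · rw [← range_comp] at hc
    obtain ⟨N, hN⟩ := capacity_aux ν (Prod.fst ∘ f) (continuous_fst.comp hf) c hc
    refine ⟨f '' {x | ∀ i, x i ≤ N i}, image_subset_range _ _, ?_, ?_⟩
    · have : {x : ℕ → ℕ | ∀ i, x i ≤ N i} = Set.univ.pi fun i => Set.Iic (N i) := by
        ext x; simp only [mem_ofPred_eq, Set.mem_univ_pi, mem_Iic]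
      rw [this]
      exact (isCompact_univ_pi fun i => (Set.finite_Iic (N i)).isCompact).image hf
    · rwa [← image_comp]

theorem polish_cantor : PolishSpace (ℕ → Bool) := by
  haveI : PolishSpace Bool := by infer_instance
  infer_instance

theorem represent (G : MeasurableSpace Ω) (E : Set (Ω × ℝ≥0))
    (hE : MeasurableSet[@Prod.instMeasurableSpace Ω ℝ≥0 G inferInstance] E) :
    ∃ φ : Ω → (ℕ → Bool), Measurable[G] φ ∧ ∃ E' : Set ((ℕ → Bool) × ℝ≥0), MeasurableSet E' ∧
      E = {p | (φ p.1, p.2) ∈ E'} := by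
  rw [← @generateFrom_prod Ω ℝ≥0 G _] at hE
  induction E, hE using MeasurableSpace.generateFrom_induction with
  | hC s hs _ =>
    obtain ⟨A, hA, B, hB, rfl⟩ := hs
    have hA' : MeasurableSet[G] A := hA
    refine ⟨fun ω _ => decide (ω ∈ A), ?_, {p | p.1 0 = true ∧ p.2 ∈ B}, ?_, ?_⟩
    · refine @measurable_pi_lambda _ _ _ G _ _ fun _ => ?_
      refine @measurable_to_bool _ G _ ?_
      convert hA' using 1
      ext ω; simp
    · have h1 : Measurable fun p : (ℕ → Bool) × ℝ≥0 => p.1 0 :=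
        (measurable_pi_apply 0).comp measurable_fst
      exact (h1 (measurableSet_singleton true)).inter (measurable_snd hB)
    · ext p; simp
  | empty => exact ⟨fun _ _ => true, measurable_const, ∅, MeasurableSet.empty, by simp⟩
  | compl s _ ih =>
    obtain ⟨φ, hφ, E', hE', rfl⟩ := ih
    exact ⟨φ, hφ, E'ᶜ, hE'.compl, rfl⟩
  | iUnion s _ ih =>
    choose φ hφ E' hE' h using ih
    refine ⟨fun ω n => φ (Nat.unpair n).1 ω (Nat.unpair n).2, ?_,
      ⋃ n, {p | ((fun m => p.1 (Nat.pair n m)), p.2) ∈ E' n}, ?_, ?_⟩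
    · refine @measurable_pi_lambda _ _ _ G _ _ fun n => ?_
      exact (measurable_pi_apply _).comp (hφ _)
    · refine MeasurableSet.iUnion fun n => ?_
      refine MeasurableSet.preimage (hE' n) (Measurable.prodMk ?_ measurable_snd)
      exact measurable_pi_lambda _ fun m => (measurable_pi_apply _).comp measurable_fst
    · ext p
      simp only [mem_iUnion, mem_ofPred_eq, Nat.unpair_pair]
      refine exists_congr fun n => ?_
      conv_lhs => rw [h n]
      rfl

attribute [local instance] polish_cantor in
theorem selector (P : Measure Ω) [IsFiniteMeasure P] (E : Set (Ω × ℝ≥0))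
    (hE : MeasurableSet E) (c : ℝ≥0∞) (hc : c < P (Prod.fst '' E)) :
    ∃ (A : Set Ω) (R : Ω → ℝ≥0), MeasurableSet A ∧ Measurable R ∧ (∀ ω ∈ A, (ω, R ω) ∈ E) ∧
      c ≤ P A := by
  obtain ⟨φ, hφ, E', hE', rfl⟩ := represent mΩ E hE
  let ν := P.map φ
  have hc' : c < ν (Prod.fst '' E') := by
    refine hc.trans_le ?_
    obtain ⟨H, hEH, hH, hHm⟩ := exists_measurable_superset ν (Prod.fst '' E')
    rw [← hHm, Measure.map_apply hφ hH]
    refine measure_mono ?_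
    rintro _ ⟨p, hp, rfl⟩
    exact hEH ⟨_, hp, rfl⟩
  obtain ⟨K, hKE, hKc, hKm⟩ := capacity ν E' hE' c hc'
  let R' : (ℕ → Bool) → ℝ≥0 := fun x => sInf {t | (x, t) ∈ K}
  have hsec : ∀ x, IsCompact {t | (x, t) ∈ K} := by
    intro x
    have : {t | (x, t) ∈ K} = Prod.snd '' (K ∩ Prod.fst ⁻¹' {x}) := by
      ext t; simp
    rw [this]
    exact (hKc.inter_right (isClosed_singleton.preimage continuous_fst)).image continuous_snd
  have hmem : ∀ x ∈ Prod.fst '' K, (x, R' x) ∈ K := by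
    rintro _ ⟨⟨x, t⟩, hp, rfl⟩
    exact (hsec x).sInf_mem ⟨t, hp⟩
  have hR' : Measurable R' := by
    refine measurable_of_Iic fun a => ?_
    have : R' ⁻¹' Iic a = (Prod.fst '' (K ∩ Prod.snd ⁻¹' Iic a)) ∪ (Prod.fst '' K)ᶜ := by
      ext x
      by_cases hx : x ∈ Prod.fst '' K
      · simp only [mem_preimage, mem_Iic, mem_union, mem_compl_iff, hx, not_true, or_false]
        constructor
        · intro h
          exact ⟨(x, R' x), ⟨hmem x hx, h⟩, rfl⟩
        · rintro ⟨⟨y, t⟩, ⟨h1, h2⟩, rfl⟩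
          exact (csInf_le (s := {t | (y, t) ∈ K}) (OrderBot.bddBelow _) h1).trans h2
      · have : {t | (x, t) ∈ K} = ∅ := by
          ext t; simp only [mem_ofPred_eq, mem_empty_iff_false, iff_false]
          exact fun h => hx ⟨_, h, rfl⟩
        have h0 : R' x = 0 := by simp only [R', this]; exact NNReal.sInf_empty
        simp only [mem_preimage, mem_Iic, mem_union, mem_compl_iff, hx, not_false_eq_true, or_true,
          h0, zero_le]
    rw [this]
    refine MeasurableSet.union ?_ ?_
    · exact ((hKc.inter_right (isClosed_Iic.preimage continuous_snd)).image
        continuous_fst).measurableSet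
    · exact (hKc.image continuous_fst).measurableSet.compl
  refine ⟨φ ⁻¹' (Prod.fst '' K), R' ∘ φ, hφ (hKc.image continuous_fst).measurableSet,
    hR'.comp hφ, fun ω hω => hKE (hmem _ hω), ?_⟩
  rwa [← Measure.map_apply hφ (hKc.image continuous_fst).measurableSet]

theorem genBy_le_iff {α : Type*} (C : Set (α → ℝ)) (m : MeasurableSpace α) :
    genBy C ≤ m ↔ ∀ f ∈ C, Measurable[m] f := by
  simp only [genBy, iSup_le_iff, measurable_iff_comap_le]

theorem measurable_genBy {α : Type*} {C : Set (α → ℝ)} {f : α → ℝ} (hf : f ∈ C) :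
    Measurable[genBy C] f := (genBy_le_iff C (genBy C)).1 le_rfl f hf

theorem inner_regular {α : Type*} [mα : MeasurableSpace α] (μ : Measure α) [IsFiniteMeasure μ]
    (C : Set (α → ℝ)) (𝒦 : Set (Set α)) (h𝒦m : ∀ K ∈ 𝒦, MeasurableSet K)
    (h0 : ∅ ∈ 𝒦) (huniv : univ ∈ 𝒦)
    (hU : ∀ K ∈ 𝒦, ∀ L ∈ 𝒦, K ∪ L ∈ 𝒦) (hI : ∀ K : ℕ → Set α, (∀ n, K n ∈ 𝒦) → ⋂ n, K n ∈ 𝒦)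
    (hle : ∀ f ∈ C, ∀ a : ℝ, {x | f x ≤ a} ∈ 𝒦) (hge : ∀ f ∈ C, ∀ a : ℝ, {x | a ≤ f x} ∈ 𝒦)
    (B : Set α) (hB : MeasurableSet[genBy C] B) (ε : ℝ≥0∞) (hε : ε ≠ 0) :
    ∃ K ∈ 𝒦, K ⊆ B ∧ μ (B \ K) ≤ ε := by
  let Q : Set α → Prop := fun B => ∀ ε : ℝ≥0∞, ε ≠ 0 → ∃ K ∈ 𝒦, K ⊆ B ∧ μ (B \ K) ≤ ε
  have hUfin : ∀ (K : ℕ → Set α), (∀ n, K n ∈ 𝒦) → ∀ n, (⋃ i < n, K i) ∈ 𝒦 := by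
    intro K hK n
    induction n with
    | zero => simpa using h0
    | succ n ih =>
      rw [Set.biUnion_lt_succ]
      exact hU _ ih _ (hK n)
  have Qunion : ∀ f : ℕ → Set α, (∀ n, MeasurableSet (f n)) → (∀ n, Q (f n)) → Q (⋃ n, f n) := by
    intro f hfm hf ε hε
    obtain ⟨δ, hδ, hδs⟩ := ENNReal.exists_pos_sum_of_countable' (ENNReal.half_pos hε).ne' ℕ
    choose K hK hKf hKμ using fun n => hf n (δ n) (hδ n).ne'
    have hlim : Tendsto (fun n => μ ((⋃ n, K n) \ ⋃ i < n, K i)) atTop (𝓝 0) := by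
      have : (⋂ n, ((⋃ n, K n) \ ⋃ i < n, K i)) = ∅ := by
        rw [← sdiff_iUnion, sdiff_eq_empty]
        refine iUnion_subset fun n x hx => mem_iUnion.2 ⟨n+1, ?_⟩
        simp only [mem_iUnion]
        exact ⟨n, Nat.lt_succ_self n, hx⟩
      rw [← measure_empty (μ := μ), ← this]
      refine tendsto_measure_iInter_atTop ?_ ?_ ⟨0, measure_ne_top _ _⟩
      · intro n
        exact ((MeasurableSet.iUnion fun n => h𝒦m _ (hK n)).diff (h𝒦m _ (hUfin K hK n))).nullMeasurableSet
      · intro a b hab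
        refine sdiff_subset_sdiff_right ?_
        exact biUnion_subset_biUnion_left fun i hi => lt_of_lt_of_le hi hab
    obtain ⟨n, hn⟩ := (hlim.eventually (ge_mem_nhds (pos_iff_ne_zero.2 (ENNReal.half_pos hε).ne'))).exists
    refine ⟨⋃ i < n, K i, hUfin K hK n, ?_, ?_⟩
    · exact iUnion₂_subset fun i _ => (hKf i).trans (subset_iUnion f i)
    · have hsub : (⋃ n, f n) \ (⋃ i < n, K i) ⊆
          (⋃ n, f n \ K n) ∪ ((⋃ n, K n) \ ⋃ i < n, K i) := by
        rintro x ⟨hx, hx2⟩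
        by_cases h : x ∈ ⋃ n, K n
        · exact Or.inr ⟨h, hx2⟩
        · obtain ⟨m, hm⟩ := mem_iUnion.1 hx
          exact Or.inl (mem_iUnion.2 ⟨m, hm, fun h' => h (mem_iUnion.2 ⟨m, h'⟩)⟩)
      calc μ _ ≤ μ (⋃ n, f n \ K n) + μ ((⋃ n, K n) \ ⋃ i < n, K i) :=
            (measure_mono hsub).trans (measure_union_le _ _)
        _ ≤ ε/2 + ε/2 := by
            refine add_le_add ?_ hn
            exact (measure_iUnion_le _).trans ((ENNReal.tsum_le_tsum hKμ).trans hδs.le)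
        _ = ε := ENNReal.add_halves ε
  have Qinter : ∀ f : ℕ → Set α, (∀ n, Q (f n)) → Q (⋂ n, f n) := by
    intro f hf ε hε
    obtain ⟨δ, hδ, hδs⟩ := ENNReal.exists_pos_sum_of_countable' hε ℕ
    choose K hK hKf hKμ using fun n => hf n (δ n) (hδ n).ne'
    refine ⟨⋂ n, K n, hI K hK, iInter_mono hKf, ?_⟩
    have hsub : (⋂ n, f n) \ (⋂ n, K n) ⊆ ⋃ n, f n \ K n := by
      rintro x ⟨hx, hx2⟩
      simp only [mem_iInter, not_forall] at hx hx2
      obtain ⟨n, hn⟩ := hx2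
      exact mem_iUnion.2 ⟨n, hx n, hn⟩
    exact (measure_mono hsub).trans
      ((measure_iUnion_le _).trans ((ENNReal.tsum_le_tsum hKμ).trans hδs.le))
  let m' : MeasurableSpace α :=
    { MeasurableSet' := fun B => MeasurableSet B ∧ Q B ∧ Q Bᶜ
      measurableSet_empty := by
        refine ⟨MeasurableSet.empty, fun ε _ => ⟨∅, h0, le_rfl, by simp⟩, ?_⟩
        exact fun ε _ => ⟨univ, huniv, by simp, by simp⟩
      measurableSet_compl := fun B h => ⟨h.1.compl, h.2.2, by rw [compl_compl]; exact h.2.1⟩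
      measurableSet_iUnion := fun f h => ⟨MeasurableSet.iUnion fun n => (h n).1,
        Qunion f (fun n => (h n).1) fun n => (h n).2.1, by
          rw [compl_iUnion]; exact Qinter _ fun n => (h n).2.2⟩ }
  have hm' : genBy C ≤ m' := by
    rw [genBy_le_iff]
    intro f hf
    refine @measurable_of_Iic _ _ _ _ _ m' _ _ _ _ fun a => ?_
    refine ⟨h𝒦m _ (hle f hf a), fun ε _ => ⟨_, hle f hf a, le_rfl, by
      rw [show f ⁻¹' Iic a = {x | f x ≤ a} from rfl, sdiff_self]; simp⟩, ?_⟩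
    have : (f ⁻¹' Iic a)ᶜ = ⋃ n : ℕ, {x | a + 1/((n:ℝ)+1) ≤ f x} := by
      ext x
      simp only [mem_compl_iff, mem_preimage, mem_Iic, not_le, mem_iUnion, mem_ofPred_eq]
      constructor
      · intro h
        obtain ⟨n, hn⟩ := exists_nat_one_div_lt (sub_pos.2 h)
        exact ⟨n, by linarith⟩
      · rintro ⟨n, hn⟩
        have : (0:ℝ) < 1/((n:ℝ)+1) := by positivity
        linarith
    rw [this]
    exact Qunion _ (fun n => h𝒦m _ (hge f hf _)) fun n ε _ => ⟨_, hge f hf _, le_rfl, by simp⟩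
  exact (hm' B hB).2.1 ε hε



set_option linter.unusedSectionVars false
set_option linter.unusedSimpArgs false
theorem sigmaAt_eq (Λ : MeasurableSpace (Ω × ℝ≥0)) (t : ℝ≥0) :
    sigmaAt Λ t = MeasurableSpace.comap (fun ω => (ω, t)) Λ := by
  apply le_antisymm
  · refine (genBy_le_iff _ _).2 ?_
    rintro f ⟨Z, hZ, rfl⟩
    exact hZ.comp (comap_measurable _)
  · rintro A ⟨B, hB, rfl⟩
    have h : Measurable[Λ] (B.indicator (fun _ => (1:ℝ))) := measurable_const.indicator hB
    have h2 : Measurable[sigmaAt Λ t] fun ω => B.indicator (fun _ => (1:ℝ)) (ω, t) :=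
      measurable_genBy ⟨_, h, rfl⟩
    convert h2 (measurableSet_singleton (1:ℝ)) using 1
    ext ω
    by_cases hω : (ω, t) ∈ B <;> simp [hω]

theorem measurableSet_sigmaAt {Λ : MeasurableSpace (Ω × ℝ≥0)} {t : ℝ≥0} {A : Set Ω} :
    MeasurableSet[sigmaAt Λ t] A ↔ ∃ B, MeasurableSet[Λ] B ∧ {ω | (ω, t) ∈ B} = A := by
  rw [sigmaAt_eq]; exact Iff.rfl

theorem sec_mem {Λ : MeasurableSpace (Ω × ℝ≥0)} {B : Set (Ω × ℝ≥0)} (hB : MeasurableSet[Λ] B)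
    (t : ℝ≥0) : MeasurableSet[sigmaAt Λ t] {ω | (ω, t) ∈ B} :=
  measurableSet_sigmaAt.2 ⟨B, hB, rfl⟩

section
variable {Λ : MeasurableSpace (Ω × ℝ≥0)} (hΛ : IsMeyer mΩ Λ)
include hΛ

theorem IsMeyer.snd : Measurable[Λ] (Prod.snd : Ω × ℝ≥0 → ℝ≥0) := by
  intro B hB
  convert hΛ.contains_borel B hB using 1
  ext p; simp

theorem IsMeyer.freeze_meas (s : ℝ≥0) : Measurable[Λ, Λ] fun p : Ω × ℝ≥0 => (p.1, min p.2 s) := by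
  intro B hB
  have h : Measurable[Λ] (B.indicator (fun _ => (1:ℝ))) := measurable_const.indicator hB
  have h2 := hΛ.stop_stable _ h s
  convert h2 (measurableSet_singleton (1:ℝ)) using 1
  ext p
  by_cases hω : (p.1, min p.2 s) ∈ B <;> simp [hω]

theorem IsMeyer.sigmaAt_le (t : ℝ≥0) : sigmaAt Λ t ≤ mΩ := by
  intro A hA
  obtain ⟨B, hB, rfl⟩ := measurableSet_sigmaAt.1 hA
  exact (@measurable_prodMk_right _ _ mΩ _ t) (hΛ.le_prod B hB)

theorem IsMeyer.sigmaInf_le : sigmaInf Λ ≤ mΩ := iSup_le hΛ.sigmaAt_le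

theorem IsMeyer.sigmaAt_mono {s t : ℝ≥0} (h : s ≤ t) : sigmaAt Λ s ≤ sigmaAt Λ t := by
  intro A hA
  obtain ⟨B, hB, rfl⟩ := measurableSet_sigmaAt.1 hA
  refine measurableSet_sigmaAt.2 ⟨_, hΛ.freeze_meas s hB, ?_⟩
  ext ω
  simp [h]

theorem IsMeyer.rect {q : ℝ≥0} {A : Set Ω} (hA : MeasurableSet[sigmaAt Λ q] A) :
    MeasurableSet[Λ] {p : Ω × ℝ≥0 | q ≤ p.2 ∧ p.1 ∈ A} := by
  obtain ⟨B, hB, rfl⟩ := measurableSet_sigmaAt.1 hA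
  have := ((hΛ.snd) (measurableSet_Ici (a := q))).inter (hΛ.freeze_meas q hB)
  convert this using 1
  ext p
  simp only [mem_ofPred_eq, mem_inter_iff, mem_preimage, mem_Ici]
  refine and_congr_right fun h => ?_
  rw [min_eq_right h]

omit hΛ in
theorem sigmaAt_le_sigmaInf (t : ℝ≥0) : sigmaAt Λ t ≤ sigmaInf Λ := le_iSup _ t

end

/-- A fixed dense sequence. -/
def dq : ℕ → ℝ≥0 := TopologicalSpace.denseSeq ℝ≥0

theorem exists_dq_btwn {a b : ℝ≥0∞} (h : a < b) : ∃ n, a < (dq n : ℝ≥0∞) ∧ (dq n : ℝ≥0∞) < b := by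
  obtain ⟨x, hx1, hx2⟩ := ENNReal.lt_iff_exists_nnreal_btwn.1 h
  obtain ⟨y, hy1, hy2⟩ := ENNReal.lt_iff_exists_nnreal_btwn.1 hx2
  obtain ⟨_, ⟨n, rfl⟩, hn1, hn2⟩ :=
    (TopologicalSpace.denseRange_denseSeq ℝ≥0).exists_between (ENNReal.coe_lt_coe.1 hy1)
  exact ⟨n, hx1.trans (ENNReal.coe_lt_coe.2 hn1), (ENNReal.coe_lt_coe.2 hn2).trans hy2⟩

section
variable {Λ : MeasurableSpace (Ω × ℝ≥0)} (hΛ : IsMeyer mΩ Λ)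
include hΛ

omit hΛ in
theorem Fplus_le {s t : ℝ≥0} (h : s < t) : FplusLambda Λ s ≤ sigmaAt Λ t :=
  iInf₂_le t h

theorem IsMeyer.sigmaAt_le_Fplus (s : ℝ≥0) : sigmaAt Λ s ≤ FplusLambda Λ s :=
  le_iInf₂ fun _ h => hΛ.sigmaAt_mono h.le

theorem IsMeyer.Fplus_mono : Monotone (FplusLambda Λ) := by
  intro s t h
  exact le_iInf₂ fun r hr => Fplus_le (h.trans_lt hr)

theorem IsMeyer.st_cl {S : Ω → ℝ≥0∞} (hS : IsStoppingTimeM Λ S) :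
    IsStoppingTimeCl (FplusLambda Λ) S := fun t =>
  hΛ.sigmaAt_le_Fplus t _ (sec_mem hS t)

variable {T : Ω → ℝ≥0∞} (hT : IsStoppingTimeCl (FplusLambda Λ) T)

omit hΛ in
include hT in
theorem lt_sigmaAt (q : ℝ≥0) : MeasurableSet[sigmaAt Λ q] {ω | T ω < q} := by
  have : {ω | T ω < q} = ⋃ n, {ω | dq n < q ∧ T ω ≤ dq n} := by
    ext ω
    simp only [mem_ofPred_eq, mem_iUnion]
    constructor
    · intro h
      obtain ⟨n, h1, h2⟩ := exists_dq_btwn h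
      exact ⟨n, by exact_mod_cast h2, h1.le⟩
    · rintro ⟨n, h1, h2⟩
      exact h2.trans_lt (by exact_mod_cast h1)
  rw [this]
  refine MeasurableSet.iUnion fun n => ?_
  by_cases h : dq n < q
  · simp only [h, true_and]
    exact Fplus_le h _ (hT _)
  · simp [h]

include hT in
theorem IsMeyer.meas_lt : MeasurableSet[Λ] {p : Ω × ℝ≥0 | T p.1 < p.2} := by
  have : {p : Ω × ℝ≥0 | T p.1 < p.2} = ⋃ n, {p | dq n ≤ p.2 ∧ p.1 ∈ {ω | T ω < dq n}} := by
    ext p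
    simp only [mem_ofPred_eq, mem_iUnion]
    constructor
    · intro h
      obtain ⟨n, h1, h2⟩ := exists_dq_btwn h
      exact ⟨n, by exact_mod_cast h2.le, h1⟩
    · rintro ⟨n, h1, h2⟩
      exact h2.trans_le (by exact_mod_cast h1)
  rw [this]
  exact MeasurableSet.iUnion fun n => hΛ.rect (lt_sigmaAt hT _)

include hT in
theorem IsMeyer.meas_lt_r (r : ℝ≥0) :
    MeasurableSet[Λ] {p : Ω × ℝ≥0 | T p.1 < p.2 ∧ T p.1 < r} := by
  have : {p : Ω × ℝ≥0 | T p.1 < p.2 ∧ T p.1 < r} =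
      ({p | T p.1 < p.2} ∩ Prod.snd ⁻¹' (Iio r)) ∪ {p | r ≤ p.2 ∧ p.1 ∈ {ω | T ω < r}} := by
    ext p
    simp only [mem_ofPred_eq, mem_union, mem_inter_iff, mem_preimage, mem_Iio]
    constructor
    · rintro ⟨h1, h2⟩
      rcases lt_or_ge p.2 r with h | h
      · exact Or.inl ⟨h1, h⟩
      · exact Or.inr ⟨h, h2⟩
    · rintro (⟨h1, h2⟩ | ⟨h1, h2⟩)
      · exact ⟨h1, h1.trans (by exact_mod_cast h2)⟩
      · exact ⟨h2.trans_le (by exact_mod_cast h1), h2⟩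
  rw [this]
  exact ((hΛ.meas_lt hT).inter (hΛ.snd measurableSet_Iio)).union (hΛ.rect (lt_sigmaAt hT r))

/-- floor approximations from above -/
def qn (n : ℕ) (x : ℝ≥0) : ℝ≥0 := ((⌊(n+1) * x⌋₊ : ℝ≥0) + 1) / (n+1)

omit mΩ hΛ in
theorem lt_qn (n : ℕ) (x : ℝ≥0) : x < qn n x := by
  unfold qn
  rw [lt_div_iff₀ (by positivity), mul_comm]
  exact Nat.lt_floor_add_one _

omit mΩ hΛ in
theorem qn_le (n : ℕ) (x : ℝ≥0) : qn n x ≤ x + 1 / (n+1) := by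
  unfold qn
  rw [add_div]
  gcongr
  rw [div_le_iff₀ (by positivity), mul_comm]
  exact Nat.floor_le zero_le

omit mΩ hΛ in
theorem qn_tendsto (x : ℝ≥0) : Tendsto (fun n => qn n x) atTop (𝓝 x) := by
  have : Tendsto (fun n : ℕ => x + 1 / ((n:ℝ≥0)+1)) atTop (𝓝 (x + 0)) :=
    tendsto_const_nhds.add tendsto_one_div_add_atTop_nhds_zero_nat
  rw [add_zero] at this
  exact tendsto_of_tendsto_of_tendsto_of_le_of_le tendsto_const_nhds this
    (fun n => (lt_qn n x).le) (fun n => qn_le n x)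

/-- Reset time to `T` after `T`. -/
def psi (T : Ω → ℝ≥0∞) (p : Ω × ℝ≥0) : Ω × ℝ≥0 := if T p.1 < p.2 then (p.1, (T p.1).toNNReal) else p

include hT in
theorem IsMeyer.psi_meas : Measurable[Λ, Λ] (psi T) := by
  obtain ⟨C, hC, hgen⟩ := hΛ.gen_cadlag
  have key : ∀ Z ∈ C, Measurable[Λ] fun p => Z (psi T p) := by
    intro Z hZ
    have hZm : Measurable[Λ] Z := by rw [hgen]; exact measurable_genBy hZ
    let ps : ℕ → Ω × ℝ≥0 → Ω × ℝ≥0 := fun n p =>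
      if T p.1 < p.2 then (p.1, min p.2 (qn n (T p.1).toNNReal)) else p
    have hps : ∀ n, Measurable[Λ, Λ] (ps n) := by
      intro n B hB
      have : ps n ⁻¹' B = (B ∩ {p | T p.1 < p.2}ᶜ) ∪ ⋃ k : ℕ,
          ({p | T p.1 < p.2 ∧ T p.1 < (((k:ℝ≥0)+1)/(n+1) : ℝ≥0)} \
            {p | T p.1 < p.2 ∧ T p.1 < ((k:ℝ≥0)/(n+1) : ℝ≥0)}) ∩
          (fun p => (p.1, min p.2 (((k:ℝ≥0)+1)/(n+1)))) ⁻¹' B := by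
        ext p
        simp only [mem_preimage, mem_union, mem_inter_iff, mem_compl_iff, mem_iUnion, Set.mem_sdiff,
          mem_ofPred_eq, ps]
        by_cases hp : T p.1 < p.2
        · simp only [hp, if_true, not_true, and_false, false_or, true_and, not_lt]
          have hfin : T p.1 ≠ ∞ := (hp.trans ENNReal.coe_lt_top).ne
          obtain ⟨x, hx⟩ : ∃ x : ℝ≥0, T p.1 = x := ⟨_, (ENNReal.coe_toNNReal hfin).symm⟩
          simp only [hx, ENNReal.toNNReal_coe, ENNReal.coe_lt_coe, ENNReal.coe_le_coe]
          constructor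
          · intro h
            refine ⟨⌊(n+1) * x⌋₊, ⟨lt_qn n x, ?_⟩, h⟩
            rw [div_le_iff₀ (by positivity), mul_comm]
            exact Nat.floor_le zero_le
          · rintro ⟨k, ⟨h1, h2⟩, h3⟩
            have : ⌊(n+1) * x⌋₊ = k := by
              rw [Nat.floor_eq_iff zero_le]
              rw [lt_div_iff₀ (by positivity), mul_comm] at h1
              rw [div_le_iff₀ (by positivity), mul_comm] at h2
              exact ⟨h2, h1⟩
            simpa only [qn, this] using h3
        · simp [hp]
      rw [this]
      refine (hB.inter (hΛ.meas_lt hT).compl).union (MeasurableSet.iUnion fun k => ?_)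
      exact ((hΛ.meas_lt_r hT _).diff (hΛ.meas_lt_r hT _)).inter (hΛ.freeze_meas _ hB)
    refine measurable_of_tendsto_metrizable (f := fun n p => Z (ps n p))
      (fun n => hZm.comp (hps n)) ?_
    rw [tendsto_pi_nhds]
    intro p
    by_cases hp : T p.1 < p.2
    · simp only [ps, psi, hp, if_true]
      have hfin : T p.1 ≠ ∞ := (hp.trans ENNReal.coe_lt_top).ne
      have hp' : (T p.1).toNNReal < p.2 := by
        rw [← ENNReal.coe_lt_coe, ENNReal.coe_toNNReal hfin]; exact hp
      refine ((hC Z hZ p.1).1 _).comp (tendsto_nhdsWithin_iff.2 ⟨?_, ?_⟩)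
      · have := (tendsto_const_nhds (x := p.2)).min (qn_tendsto (T p.1).toNNReal)
        rwa [min_eq_right hp'.le] at this
      · exact Eventually.of_forall fun n => le_min hp'.le (lt_qn _ _).le
    · simp only [ps, psi, hp, if_false]
      exact tendsto_const_nhds
  rw [measurable_iff_comap_le]
  conv_lhs => rw [hgen]
  rw [← measurable_iff_comap_le]
  intro B hB
  have : genBy C ≤ MeasurableSpace.map (psi T) Λ := by
    rw [genBy_le_iff]
    intro Z hZ D hD
    exact key Z hZ hD
  exact this B hB

end


section
variable {Λ : MeasurableSpace (Ω × ℝ≥0)} (hΛ : IsMeyer mΩ Λ)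
include hΛ

theorem IsMeyer.lt_graph {T : Ω → ℝ≥0∞} (hT : IsStoppingTimeCl (FplusLambda Λ) T)
    {B : Set (Ω × ℝ≥0)} (hB : MeasurableSet[Λ] B) :
    MeasurableSet[Λ] {p : Ω × ℝ≥0 | T p.1 < p.2 ∧ (p.1, (T p.1).toNNReal) ∈ B} := by
  convert (hΛ.meas_lt hT).inter (hΛ.psi_meas hT hB) using 1
  ext p
  simp only [mem_ofPred_eq, mem_inter_iff, mem_preimage, psi]
  refine and_congr_right fun h => ?_
  rw [if_pos h]

theorem IsMeyer.restrict_graph {V : Ω → ℝ≥0∞} (hV : IsStoppingTimeM Λ V)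
    {B : Set (Ω × ℝ≥0)} (hB : MeasurableSet[Λ] B) :
    MeasurableSet[Λ] {p : Ω × ℝ≥0 | V p.1 ≤ p.2 ∧ (p.1, (V p.1).toNNReal) ∈ B} := by
  have hV' : MeasurableSet[Λ] {p : Ω × ℝ≥0 | V p.1 ≤ (p.2 : ℝ≥0∞)} := hV
  convert ((hV'.diff (hΛ.meas_lt (hΛ.st_cl hV))).inter hB).union
    (hΛ.lt_graph (hΛ.st_cl hV) hB) using 1
  ext p
  simp only [mem_ofPred_eq, mem_union, mem_inter_iff, Set.mem_sdiff, not_lt]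
  constructor
  · rintro ⟨h1, h2⟩
    rcases h1.lt_or_eq with h | h
    · exact Or.inr ⟨h, h2⟩
    · left
      refine ⟨⟨h1, h.ge⟩, ?_⟩
      rw [h, ENNReal.toNNReal_coe] at h2
      exact h2
  · rintro (⟨⟨h1, h2⟩, h3⟩ | ⟨h1, h2⟩)
    · refine ⟨h1, ?_⟩
      rw [le_antisymm h1 h2, ENNReal.toNNReal_coe]
      exact h3
    · exact ⟨h1.le, h2⟩

/-- the explicit description of `F^Λ_S` -/
@[reducible] def sigmaEx (Λ : MeasurableSpace (Ω × ℝ≥0)) (S : Ω → ℝ≥0∞) (hS : IsStoppingTimeM Λ S) :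
    MeasurableSpace Ω where
  MeasurableSet' A := MeasurableSet[sigmaInf Λ] A ∧
    MeasurableSet[Λ] {p : Ω × ℝ≥0 | S p.1 ≤ p.2 ∧ p.1 ∈ A}
  measurableSet_empty := ⟨@MeasurableSet.empty _ (sigmaInf Λ), by simp⟩
  measurableSet_compl A h := by
    refine ⟨@MeasurableSet.compl _ _ (sigmaInf Λ) h.1, ?_⟩
    convert (MeasurableSet.diff (show MeasurableSet[Λ] {p : Ω × ℝ≥0 | S p.1 ≤ p.2} from hS) h.2) using 1
    ext p
    simp only [mem_ofPred_eq, Set.mem_sdiff, mem_compl_iff]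
    tauto
  measurableSet_iUnion f h := by
    refine ⟨@MeasurableSet.iUnion _ _ (sigmaInf Λ) _ _ fun n => (h n).1, ?_⟩
    convert MeasurableSet.iUnion fun n => (h n).2 using 1
    ext p
    simp only [mem_ofPred_eq, mem_iUnion]
    exact ⟨fun ⟨a, n, b⟩ => ⟨n, a, b⟩, fun ⟨n, a, b⟩ => ⟨a, n, b⟩⟩

theorem IsMeyer.fin_sigmaInf {S : Ω → ℝ≥0∞} {B : Set (Ω × ℝ≥0)}
    (hB : MeasurableSet[Λ] {p : Ω × ℝ≥0 | S p.1 ≤ p.2 ∧ (p.1, (S p.1).toNNReal) ∈ B}) :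
    MeasurableSet[sigmaInf Λ] {ω | S ω < ∞ ∧ (ω, (S ω).toNNReal) ∈ B} := by
  have : {ω | S ω < ∞ ∧ (ω, (S ω).toNNReal) ∈ B} =
      ⋃ n : ℕ, {ω | (ω, (n : ℝ≥0)) ∈ {p : Ω × ℝ≥0 | S p.1 ≤ p.2 ∧ (p.1, (S p.1).toNNReal) ∈ B}} := by
    ext ω
    simp only [mem_ofPred_eq, mem_iUnion]
    constructor
    · rintro ⟨h1, h2⟩
      obtain ⟨n, hn⟩ := ENNReal.exists_nat_gt h1.ne
      exact ⟨n, by exact_mod_cast hn.le, h2⟩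
    · rintro ⟨n, h1, h2⟩
      exact ⟨h1.trans_lt (by simp), h2⟩
  rw [this]
  refine @MeasurableSet.iUnion _ _ (sigmaInf Λ) _ _ fun n => ?_
  exact sigmaAt_le_sigmaInf _ _ (sec_mem hB _)

theorem IsMeyer.sigmaAtTime_eq {S : Ω → ℝ≥0∞} (hS : IsStoppingTimeM Λ S) :
    sigmaAtTime Λ S = sigmaEx Λ S hS := by
  apply le_antisymm
  · refine (genBy_le_iff _ _).2 ?_
    rintro f ⟨Z, ⟨hZ, hZi⟩, rfl⟩ D hD
    have h1 := hΛ.restrict_graph hS (hZ hD)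
    refine ⟨?_, ?_⟩
    · have h2 := hΛ.fin_sigmaInf h1
      have h3 := hΛ.fin_sigmaInf (hΛ.restrict_graph hS (@MeasurableSet.univ _ Λ))
      have h4 : MeasurableSet[sigmaInf Λ] _ := hZi hD
      convert @MeasurableSet.union _ (sigmaInf Λ) _ _ h2
        (@MeasurableSet.diff _ (sigmaInf Λ) _ _ h4 h3) using 1
      ext ω
      simp only [mem_preimage, mem_union, mem_ofPred_eq, Set.mem_sdiff, mem_univ, and_true, not_lt,
        top_le_iff]
      by_cases h : S ω = ∞
      · simp [h]
      · simp [h, lt_top_iff_ne_top]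
    · convert h1 using 1
      ext p
      simp only [mem_ofPred_eq, mem_preimage]
      refine and_congr_right fun h => ?_
      rw [ENNReal.coe_toNNReal (h.trans_lt ENNReal.coe_lt_top).ne]
  · intro A hA
    obtain ⟨hA1, hA2⟩ := hA
    let Z : Ω × ℝ≥0∞ → ℝ := fun p => if S p.1 ≤ p.2 ∧ p.1 ∈ A then 1 else 0
    have hZ : MeasurableProcessE Λ Z := by
      refine ⟨?_, ?_⟩
      · exact Measurable.ite hA2 measurable_const measurable_const
      · simp only [Z, le_top, true_and]
        let _ : MeasurableSpace Ω := sigmaInf Λ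
        exact Measurable.ite hA1 measurable_const measurable_const
    have h2 : Measurable[sigmaAtTime Λ S] fun ω => Z (ω, S ω) := measurable_genBy ⟨_, hZ, rfl⟩
    convert h2 (measurableSet_singleton (1:ℝ)) using 1
    ext ω
    by_cases hω : ω ∈ A <;> simp [hω, Z]

theorem IsMeyer.mem_sigmaAtTime {S : Ω → ℝ≥0∞} (hS : IsStoppingTimeM Λ S) {A : Set Ω} :
    MeasurableSet[sigmaAtTime Λ S] A ↔ MeasurableSet[sigmaInf Λ] A ∧
    MeasurableSet[Λ] {p : Ω × ℝ≥0 | S p.1 ≤ p.2 ∧ p.1 ∈ A} := by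
  rw [hΛ.sigmaAtTime_eq hS]; exact Iff.rfl

theorem IsMeyer.sigmaAtTime_le {S : Ω → ℝ≥0∞} (hS : IsStoppingTimeM Λ S) :
    sigmaAtTime Λ S ≤ mΩ := fun _ hA =>
  hΛ.sigmaInf_le _ ((hΛ.mem_sigmaAtTime hS).1 hA).1

theorem IsMeyer.sigmaAtTime_mono {S T : Ω → ℝ≥0∞} (hS : IsStoppingTimeM Λ S)
    (hT : IsStoppingTimeM Λ T) (hST : S ≤ T) : sigmaAtTime Λ S ≤ sigmaAtTime Λ T := by
  intro A hA
  rw [hΛ.mem_sigmaAtTime hS] at hA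
  rw [hΛ.mem_sigmaAtTime hT]
  refine ⟨hA.1, ?_⟩
  convert MeasurableSet.inter (show MeasurableSet[Λ] {p : Ω × ℝ≥0 | T p.1 ≤ p.2} from hT) hA.2 using 1
  ext p
  simp only [mem_ofPred_eq, mem_inter_iff]
  exact ⟨fun h => ⟨h.1, (hST _).trans h.1, h.2⟩, fun h => ⟨h.1, h.2.2⟩⟩

omit hΛ in
theorem evalAt_meas_sigma {S : Ω → ℝ≥0∞} {Z : Ω × ℝ≥0∞ → ℝ} (hZ : MeasurableProcessE Λ Z) :
    Measurable[sigmaAtTime Λ S] (EvalAt Z S) := measurable_genBy ⟨Z, hZ, rfl⟩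

theorem IsMeyer.evalAt_meas {S : Ω → ℝ≥0∞} (hS : IsStoppingTimeM Λ S) {Z : Ω × ℝ≥0∞ → ℝ}
    (hZ : MeasurableProcessE Λ Z) : Measurable[mΩ] (EvalAt Z S) :=
  (evalAt_meas_sigma hZ).mono (hΛ.sigmaAtTime_le hS) le_rfl

theorem IsMeyer.const_st (c : ℝ≥0∞) : IsStoppingTimeM Λ (fun _ => c) := by
  have : MeasurableSet {t : ℝ≥0 | c ≤ (t : ℝ≥0∞)} :=
    measurableSet_le measurable_const ENNReal.continuous_coe.measurable
  exact hΛ.snd this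

omit hΛ in
theorem min_st {S T : Ω → ℝ≥0∞} (hS : IsStoppingTimeM Λ S) (hT : IsStoppingTimeM Λ T) :
    IsStoppingTimeM Λ (fun ω => min (S ω) (T ω)) := by
  unfold IsStoppingTimeM
  convert MeasurableSet.union hS hT using 1
  ext p; simp

omit hΛ in
theorem max_st {S T : Ω → ℝ≥0∞} (hS : IsStoppingTimeM Λ S) (hT : IsStoppingTimeM Λ T) :
    IsStoppingTimeM Λ (fun ω => max (S ω) (T ω)) := by
  unfold IsStoppingTimeM
  convert MeasurableSet.inter hS hT using 1
  ext p; simp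

omit hΛ in
theorem iSup_st {S : ℕ → Ω → ℝ≥0∞} (hS : ∀ n, IsStoppingTimeM Λ (S n)) :
    IsStoppingTimeM Λ (fun ω => ⨆ n, S n ω) := by
  unfold IsStoppingTimeM
  convert MeasurableSet.iInter hS using 1
  ext p; simp

theorem IsMeyer.restrict_st {S : Ω → ℝ≥0∞} (hS : IsStoppingTimeM Λ S) {A : Set Ω}
    (hA : MeasurableSet[sigmaAtTime Λ S] A) : IsStoppingTimeM Λ (restrictST S A) := by
  unfold IsStoppingTimeM
  convert ((hΛ.mem_sigmaAtTime hS).1 hA).2 using 1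
  ext p
  by_cases h : p.1 ∈ A <;> simp [restrictST, h]

theorem IsMeyer.cl_measurable {T : Ω → ℝ≥0∞} (hT : IsStoppingTimeCl (FplusLambda Λ) T) :
    Measurable[mΩ] T := by
  refine measurable_of_Iic fun a => ?_
  by_cases ha : a = ∞
  · simp [ha]
  · lift a to ℝ≥0 using ha
    exact hΛ.sigmaAt_le (a+1) _ (Fplus_le (lt_add_one a) _ (hT a))

theorem IsMeyer.st_measurable {S : Ω → ℝ≥0∞} (hS : IsStoppingTimeM Λ S) : Measurable[mΩ] S :=
  hΛ.cl_measurable (hΛ.st_cl hS)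

end


theorem IsCadlag.max {f g : ℝ≥0 → ℝ} (hf : IsCadlag f) (hg : IsCadlag g) :
    IsCadlag fun t => max (f t) (g t) := by
  refine ⟨fun t => (hf.1 t).max (hg.1 t), fun t ht => ?_⟩
  obtain ⟨l, hl⟩ := hf.2 t ht
  obtain ⟨l', hl'⟩ := hg.2 t ht
  exact ⟨_, hl.max hl'⟩

theorem IsCadlag.const_sub {f : ℝ≥0 → ℝ} (hf : IsCadlag f) (a : ℝ) :
    IsCadlag fun t => a - f t := by
  refine ⟨fun t => tendsto_const_nhds.sub (hf.1 t), fun t ht => ?_⟩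
  obtain ⟨l, hl⟩ := hf.2 t ht
  exact ⟨_, tendsto_const_nhds.sub hl⟩

theorem IsCadlag.sub_const {f : ℝ≥0 → ℝ} (hf : IsCadlag f) (a : ℝ) :
    IsCadlag fun t => f t - a := by
  refine ⟨fun t => (hf.1 t).sub tendsto_const_nhds, fun t ht => ?_⟩
  obtain ⟨l, hl⟩ := hf.2 t ht
  exact ⟨_, hl.sub tendsto_const_nhds⟩

theorem isCadlag_const (a : ℝ) : IsCadlag fun _ => a :=
  ⟨fun _ => tendsto_const_nhds, fun _ _ => ⟨a, tendsto_const_nhds⟩⟩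

/-- the paving for the section theorem -/
def pav (Λ : MeasurableSpace (Ω × ℝ≥0)) : Set (Set (Ω × ℝ≥0)) :=
  {K | ∃ Y : ℕ → Ω × ℝ≥0 → ℝ, (∀ n, Measurable[Λ] (Y n)) ∧
    (∀ n ω, IsCadlag fun t => Y n (ω, t)) ∧ K = ⋂ n, {p | 0 ≤ Y n p}}

/-- the set whose debut is the next iterate -/
def GV (V : Ω → ℝ≥0∞) (Y : Ω × ℝ≥0 → ℝ) : Set (Ω × ℝ≥0) :=
  {p | V p.1 ≤ p.2 ∧ ∀ k : ℕ, -(1/((k:ℝ)+1)) < Y p ∨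
    ∃ n, V p.1 ≤ dq n ∧ dq n < p.2 ∧ -(1/((k:ℝ)+1)) < Y (p.1, dq n)}

def TV (V : Ω → ℝ≥0∞) (Y : Ω × ℝ≥0 → ℝ) (ω : Ω) : ℝ≥0∞ :=
  ⨅ (t : ℝ≥0) (_ : (ω, t) ∈ GV V Y), (t : ℝ≥0∞)

theorem GV_up {V : Ω → ℝ≥0∞} {Y : Ω × ℝ≥0 → ℝ} (hY : ∀ ω, IsCadlag fun t => Y (ω, t))
    {ω : Ω} {s t : ℝ≥0} (hst : s < t) (hs : (ω, s) ∈ GV V Y) : (ω, t) ∈ GV V Y := by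
  refine ⟨hs.1.trans (by exact_mod_cast hst.le), fun k => Or.inr ?_⟩
  rcases hs.2 k with h | ⟨n, h1, h2, h3⟩
  · have h1 := ((hY ω).1 s).eventually (lt_mem_nhds h)
    obtain ⟨u, hu, hu'⟩ := (mem_nhdsGE_iff_exists_Ico_subset' hst).1 h1
    obtain ⟨n, hn1, hn2⟩ := exists_dq_btwn (ENNReal.coe_lt_coe.2 (lt_min hu hst))
    rw [ENNReal.coe_lt_coe] at hn1 hn2
    exact ⟨n, hs.1.trans (by exact_mod_cast hn1.le), hn2.trans_le (min_le_right _ _),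
      hu' ⟨hn1.le, hn2.trans_le (min_le_left _ _)⟩⟩
  · exact ⟨n, h1, h2.trans hst, h3⟩

theorem GV_closed {V : Ω → ℝ≥0∞} {Y : Ω × ℝ≥0 → ℝ} (hY : ∀ ω, IsCadlag fun t => Y (ω, t))
    {ω : Ω} {t : ℝ≥0} (h : ∀ s > t, (ω, s) ∈ GV V Y) : (ω, t) ∈ GV V Y := by
  refine ⟨?_, fun k => ?_⟩
  · refine le_of_forall_gt fun c hc => ?_
    obtain ⟨n, h1, h2⟩ := exists_dq_btwn hc
    exact ((h (dq n) (by exact_mod_cast h1)).1).trans_lt h2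
  · by_contra hcon
    push Not at hcon
    obtain ⟨hc1, hc2⟩ := hcon
    have hk : -(1/((k:ℝ)+1)) < -(1/(((k+1:ℕ):ℝ)+1)) := by
      rw [neg_lt_neg_iff]
      push_cast
      exact one_div_lt_one_div_of_lt (by positivity) (by linarith)
    have h1 := ((hY ω).1 t).eventually (gt_mem_nhds (hc1.trans_lt hk))
    obtain ⟨u, hu, hu'⟩ := (mem_nhdsGE_iff_exists_Ico_subset' (lt_add_one t)).1 h1
    obtain ⟨s, hs1, hs2⟩ := exists_between (show t < u from hu)
    rcases (h s hs1).2 (k+1) with h3 | ⟨n, h3, h4, h5⟩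
    · exact lt_asymm h3 (hu' ⟨hs1.le, hs2⟩)
    · rcases lt_or_ge (dq n) t with h6 | h6
      · exact absurd (h5.trans_le (hc2 n h3 h6)) (not_lt.2 hk.le)
      · exact lt_asymm h5 (hu' ⟨h6, h4.trans hs2⟩)

theorem TV_le_iff {V : Ω → ℝ≥0∞} {Y : Ω × ℝ≥0 → ℝ} (hY : ∀ ω, IsCadlag fun t => Y (ω, t))
    {ω : Ω} {t : ℝ≥0} : TV V Y ω ≤ t ↔ (ω, t) ∈ GV V Y := by
  constructor
  · intro h
    refine GV_closed hY fun s hs => ?_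
    have h2 : TV V Y ω < s := h.trans_lt (by exact_mod_cast hs)
    simp only [TV, iInf_lt_iff] at h2
    obtain ⟨u, hu, hus⟩ := h2
    exact GV_up hY (by exact_mod_cast hus) hu
  · intro h
    exact iInf₂_le t h

theorem le_TV {V : Ω → ℝ≥0∞} {Y : Ω × ℝ≥0 → ℝ} (ω : Ω) : V ω ≤ TV V Y ω :=
  le_iInf₂ fun _ h => h.1

section
variable {Λ : MeasurableSpace (Ω × ℝ≥0)} (hΛ : IsMeyer mΩ Λ)
include hΛ

theorem IsMeyer.TV_st {V : Ω → ℝ≥0∞} (hV : IsStoppingTimeM Λ V) {Y : Ω × ℝ≥0 → ℝ}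
    (hY : ∀ ω, IsCadlag fun t => Y (ω, t)) (hYm : Measurable[Λ] Y) :
    IsStoppingTimeM Λ (TV V Y) := by
  have : {p : Ω × ℝ≥0 | TV V Y p.1 ≤ p.2} = GV V Y := by
    ext p; exact TV_le_iff hY
  unfold IsStoppingTimeM
  rw [this]
  have h1 : GV V Y = {p : Ω × ℝ≥0 | V p.1 ≤ p.2} ∩ ⋂ k : ℕ, ({p | -(1/((k:ℝ)+1)) < Y p} ∪
      ⋃ n, ({p | dq n ≤ p.2 ∧ p.1 ∈ {ω | (ω, dq n) ∈ {p : Ω × ℝ≥0 | V p.1 ≤ p.2} ∩ {p | -(1/((k:ℝ)+1)) < Y p}}} ∩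
        Prod.snd ⁻¹' (Ioi (dq n)))) := by
    ext p
    simp only [GV, mem_ofPred_eq, mem_inter_iff, mem_iInter, mem_union, mem_iUnion, mem_preimage, mem_Ioi]
    refine and_congr_right fun _ => forall_congr' fun k => or_congr_right (exists_congr fun n => ?_)
    exact ⟨fun h => ⟨⟨h.2.1.le, h.1, h.2.2⟩, h.2.1⟩, fun h => ⟨h.1.2.1, h.2, h.1.2.2⟩⟩
  rw [h1]
  have hYk : ∀ k : ℕ, MeasurableSet[Λ] {p | -(1/((k:ℝ)+1)) < Y p} := fun k =>
    hYm measurableSet_Ioi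
  refine MeasurableSet.inter hV (MeasurableSet.iInter fun k => (hYk k).union
    (MeasurableSet.iUnion fun n => MeasurableSet.inter ?_ (hΛ.snd measurableSet_Ioi)))
  exact hΛ.rect (sec_mem (MeasurableSet.inter hV (hYk k)) _)

theorem IsMeyer.pav_section (P : Measure Ω) [IsProbabilityMeasure P] {K : Set (Ω × ℝ≥0)}
    (hK : K ∈ pav Λ) : ∃ U : Ω → ℝ≥0∞, IsStoppingTimeM Λ U ∧
      (∀ ω, U ω ≠ ∞ → (ω, (U ω).toNNReal) ∈ K) ∧ P (Prod.fst '' K \ {ω | U ω < ∞}) = 0 := by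
  obtain ⟨Y, hYm, hYc, rfl⟩ := hK
  set K : Set (Ω × ℝ≥0) := ⋂ n, {p | 0 ≤ Y n p} with hKdef
  have hKm : MeasurableSet[Λ] K := MeasurableSet.iInter fun n => hYm n measurableSet_Ici
  let 𝒱 : Set (Ω → ℝ≥0∞) := {V | IsStoppingTimeM Λ V ∧ ∀ p ∈ K, V p.1 ≤ p.2}
  let φ : (Ω → ℝ≥0∞) → ℝ≥0∞ := fun V => ∫⁻ ω, (1 + V ω)⁻¹ ∂P
  have hφ1 : ∀ V, φ V ≤ 1 := by
    intro V
    calc φ V ≤ ∫⁻ _, 1 ∂P := lintegral_mono fun ω => by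
            rw [ENNReal.inv_le_one]; exact le_self_add
      _ = 1 := by simp
  let c := ⨅ V ∈ 𝒱, φ V
  have h0 : (fun _ => 0) ∈ 𝒱 := ⟨hΛ.const_st 0, fun _ _ => zero_le⟩
  have hc : c ≠ ∞ := ((iInf₂_le _ h0).trans (hφ1 _)).trans_lt ENNReal.one_lt_top |>.ne
  have hV : ∀ n : ℕ, ∃ V ∈ 𝒱, φ V < c + ((n:ℝ≥0∞)+1)⁻¹ := by
    intro n
    have : c < c + ((n:ℝ≥0∞)+1)⁻¹ := ENNReal.lt_add_right hc (by simp)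
    simpa only [c, iInf_lt_iff, exists_prop] using this
  choose V hV hVc using hV
  let Vs : Ω → ℝ≥0∞ := fun ω => ⨆ n, V n ω
  have hVs : Vs ∈ 𝒱 := ⟨iSup_st fun n => (hV n).1, fun p hp => iSup_le fun n => (hV n).2 p hp⟩
  have hφs : φ Vs ≤ c := by
    have h1 : ∀ n : ℕ, φ Vs ≤ c + ((n:ℝ≥0∞)+1)⁻¹ := fun n =>
      (lintegral_mono fun ω => ENNReal.inv_le_inv.2 (add_le_add le_rfl (le_iSup (fun n => V n ω) n))).trans (hVc n).le
    have h2 : Tendsto (fun n : ℕ => c + ((n:ℝ≥0∞)+1)⁻¹) atTop (𝓝 (c + 0)) := by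
      refine tendsto_const_nhds.add ?_
      have := (tendsto_add_atTop_iff_nat 1).2 ENNReal.tendsto_inv_nat_nhds_zero
      simpa using this
    rw [add_zero] at h2
    exact ge_of_tendsto' h2 h1
  have hTV : ∀ n, TV Vs (Y n) ∈ 𝒱 := by
    intro n
    refine ⟨hΛ.TV_st hVs.1 (hYc n) (hYm n), fun p hp => ?_⟩
    rw [show p = (p.1, p.2) from rfl] at hp
    refine (TV_le_iff (hYc n)).2 ⟨hVs.2 p hp, fun k => Or.inl ?_⟩
    have h1 : 0 ≤ Y n p := mem_iInter.1 hp n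
    have : (0:ℝ) < 1/((k:ℝ)+1) := by positivity
    exact lt_of_lt_of_le (by linarith) h1
  have hae : ∀ᵐ ω ∂P, ∀ n, TV Vs (Y n) ω = Vs ω := by
    rw [ae_all_iff]
    intro n
    have h1 : (fun ω => (1 + TV Vs (Y n) ω)⁻¹) =ᵐ[P] fun ω => (1 + Vs ω)⁻¹ := by
      refine ae_eq_of_ae_le_of_lintegral_le ?_ ?_ ?_ ?_
      · exact Eventually.of_forall fun ω => ENNReal.inv_le_inv.2 (add_le_add le_rfl (le_TV ω))
      · exact ((hφ1 _).trans_lt ENNReal.one_lt_top).ne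
      · exact ((measurable_const.add (hΛ.st_measurable hVs.1)).inv).aemeasurable
      · exact hφs.trans (iInf₂_le _ (hTV n))
    filter_upwards [h1] with ω hω
    have h2 := inv_injective hω
    exact (ENNReal.add_right_inj ENNReal.one_ne_top).1 h2
  refine ⟨fun ω => if (ω, (Vs ω).toNNReal) ∈ K then Vs ω else ∞, ?_, ?_, ?_⟩
  · have := hΛ.restrict_graph hVs.1 hKm
    unfold IsStoppingTimeM
    convert this using 1
    ext p
    by_cases h : (p.1, (Vs p.1).toNNReal) ∈ K <;> simp [h]
  · intro ω h
    by_cases h2 : (ω, (Vs ω).toNNReal) ∈ K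
    · simp [h2]
    · simp [h2] at h
  · refine measure_mono_null ?_ hae
    rintro _ ⟨⟨p, hp, rfl⟩, hp2⟩ hcon
    apply hp2
    have hfin : Vs p.1 < ∞ := (hVs.2 p hp).trans_lt ENNReal.coe_lt_top
    have hmem : (p.1, (Vs p.1).toNNReal) ∈ K := by
      rw [hKdef, mem_iInter]
      intro n
      have h3 : TV Vs (Y n) p.1 ≤ ((Vs p.1).toNNReal : ℝ≥0∞) := by
        rw [hcon n, ENNReal.coe_toNNReal hfin.ne]
      rw [TV_le_iff (hYc n)] at h3
      show 0 ≤ Y n (p.1, (Vs p.1).toNNReal)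
      refine le_of_forall_lt fun a ha => ?_
      obtain ⟨k, hk⟩ := exists_nat_one_div_lt (neg_pos.2 ha)
      rcases h3.2 k with h4 | ⟨m, h4, h5, _⟩
      · linarith
      · simp only at h4 h5
        exfalso
        rw [← ENNReal.coe_lt_coe, ENNReal.coe_toNNReal hfin.ne] at h5
        exact absurd h4 (not_le.2 h5)
    simp [hmem, hfin]

theorem IsMeyer.pav_regular (μ : @Measure (Ω × ℝ≥0) (mΩ.prod inferInstance)) [@IsFiniteMeasure _ (mΩ.prod inferInstance) μ]
    {B : Set (Ω × ℝ≥0)} (hB : MeasurableSet[Λ] B) {ε : ℝ≥0∞} (hε : ε ≠ 0) :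
    ∃ K ∈ pav Λ, K ⊆ B ∧ μ (B \ K) ≤ ε := by
  obtain ⟨C, hC, hgen⟩ := hΛ.gen_cadlag
  have hCm : ∀ f ∈ C, Measurable[Λ] f := by
    intro f hf; rw [hgen]; exact measurable_genBy hf
  rw [hgen] at hB
  refine @inner_regular _ (mΩ.prod inferInstance) μ _ C (pav Λ) ?_ ?_ ?_ ?_ ?_ ?_ ?_ B hB ε hε
  · rintro K ⟨Y, hY, -, rfl⟩
    exact hΛ.le_prod _ (MeasurableSet.iInter fun n => hY n measurableSet_Ici)
  · refine ⟨fun _ _ => -1, fun _ => measurable_const, fun _ _ => isCadlag_const _, ?_⟩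
    ext p; simp
  · exact ⟨fun _ _ => 0, fun _ => measurable_const, fun _ _ => isCadlag_const _, by simp⟩
  · rintro _ ⟨Y, hY, hYc, rfl⟩ _ ⟨Y', hY', hYc', rfl⟩
    refine ⟨fun n p => max (Y n.unpair.1 p) (Y' n.unpair.2 p), fun n => (hY _).max (hY' _),
      fun n ω => (hYc _ ω).max (hYc' _ ω), ?_⟩
    ext p
    simp only [mem_union, mem_iInter, mem_ofPred_eq, le_max_iff]
    constructor
    · rintro (h | h) n
      · exact Or.inl (h _)
      · exact Or.inr (h _)
    · intro h
      by_contra hcon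
      push Not at hcon
      obtain ⟨⟨i, hi⟩, ⟨j, hj⟩⟩ := hcon
      have := h (Nat.pair i j)
      rw [Nat.unpair_pair] at this
      rcases this with h | h
      · exact absurd h (not_le.2 hi)
      · exact absurd h (not_le.2 hj)
  · intro K hK
    choose Y hY hYc hKe using hK
    refine ⟨fun n => Y n.unpair.1 n.unpair.2, fun n => hY _ _, fun n => hYc _ _, ?_⟩
    ext p
    simp only [hKe, mem_iInter, mem_ofPred_eq]
    exact ⟨fun h n => h _ _, fun h i j => by simpa using h (Nat.pair i j)⟩
  · intro f hf a
    refine ⟨fun _ p => a - f p, fun _ => (hCm f hf).const_sub a, fun _ ω => (hC f hf ω).const_sub a, ?_⟩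
    ext p; simp
  · intro f hf a
    refine ⟨fun _ p => f p - a, fun _ => (hCm f hf).sub_const a, fun _ ω => (hC f hf ω).sub_const a, ?_⟩
    ext p; simp

theorem IsMeyer.section_thm (P : Measure Ω) [IsProbabilityMeasure P] {B : Set (Ω × ℝ≥0)}
    (hB : MeasurableSet[Λ] B) {ε : ℝ≥0∞} (hε : ε ≠ 0) : ∃ U : Ω → ℝ≥0∞, IsStoppingTimeM Λ U ∧
      (∀ ω, U ω ≠ ∞ → (ω, (U ω).toNNReal) ∈ B) ∧ P (Prod.fst '' B \ {ω | U ω < ∞}) ≤ ε := by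
  by_cases h0 : P (Prod.fst '' B) = 0
  · refine ⟨fun _ => ∞, hΛ.const_st ∞, fun ω h => absurd rfl h, ?_⟩
    exact (measure_mono sdiff_subset).trans (h0.le.trans zero_le)
  have hε2 : ε / 2 ≠ 0 := (ENNReal.half_pos hε).ne'
  have hlt : P (Prod.fst '' B) - ε/2 < P (Prod.fst '' B) :=
    ENNReal.sub_lt_self (measure_ne_top _ _) h0 hε2
  obtain ⟨A, R, hA, hR, hAR, hcA⟩ := selector P B (hΛ.le_prod _ hB) _ hlt
  have hf : @Measurable _ _ mΩ (mΩ.prod inferInstance) (fun ω => (ω, R ω)) :=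
    (@measurable_id _ mΩ).prodMk hR
  let μ : @Measure (Ω × ℝ≥0) (mΩ.prod inferInstance) :=
    @Measure.map _ _ mΩ (mΩ.prod inferInstance) (fun ω => (ω, R ω)) (P.restrict A)
  have hμ : @IsFiniteMeasure _ (mΩ.prod inferInstance) μ := by
    refine @IsFiniteMeasure.mk _ (mΩ.prod inferInstance) μ ?_
    rw [@Measure.map_apply _ _ mΩ (mΩ.prod inferInstance) _ _ hf _ (@MeasurableSet.univ _ (mΩ.prod inferInstance))]
    exact measure_lt_top _ _
  obtain ⟨K, hK, hKB, hKμ⟩ := hΛ.pav_regular μ hB hε2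
  have hKm : MeasurableSet[Λ] K := by
    obtain ⟨Y, hY, -, rfl⟩ := hK
    exact MeasurableSet.iInter fun n => hY n measurableSet_Ici
  obtain ⟨U, hU, hUK, hUP⟩ := hΛ.pav_section P hK
  have hUm : MeasurableSet {ω | U ω < ∞} := measurableSet_lt (hΛ.st_measurable hU) measurable_const
  refine ⟨U, hU, fun ω h => hKB (hUK ω h), ?_⟩
  rw [@Measure.map_apply _ _ mΩ (mΩ.prod inferInstance) _ _ hf _ (hΛ.le_prod _ (hB.diff hKm)),
    Measure.restrict_apply (hf (hΛ.le_prod _ (hB.diff hKm)))] at hKμ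
  have hsub : {ω | U ω < ∞} ⊆ Prod.fst '' B := fun ω h => ⟨_, hKB (hUK ω (ne_of_lt h)), rfl⟩
  have h1 := measure_inter_add_sdiff (μ := P) (Prod.fst '' B) hUm
  rw [inter_eq_self_of_subset_right hsub] at h1
  have h2 : P A ≤ P {ω | U ω < ∞} + ε/2 := by
    have : A ⊆ {ω | U ω < ∞} ∪ ((fun ω => (ω, R ω)) ⁻¹' (B \ K) ∩ A) ∪
        (Prod.fst '' K \ {ω | U ω < ∞}) := by
      intro ω hω
      by_cases h3 : (ω, R ω) ∈ K
      · by_cases h4 : U ω < ∞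
        · exact Or.inl (Or.inl h4)
        · exact Or.inr ⟨⟨_, h3, rfl⟩, h4⟩
      · exact Or.inl (Or.inr ⟨⟨hAR ω hω, h3⟩, hω⟩)
    refine (measure_mono this).trans ((measure_union_le _ _).trans ?_)
    rw [hUP, add_zero]
    exact (measure_union_le _ _).trans (add_le_add le_rfl hKμ)
  have h3 : P (Prod.fst '' B) ≤ P {ω | U ω < ∞} + ε := by
    have := tsub_le_iff_right.1 (hcA.trans h2)
    rwa [add_assoc, ENNReal.add_halves] at this
  rw [← h1] at h3
  exact (ENNReal.add_le_add_iff_left (measure_ne_top _ _)).1 h3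

end


theorem IsMartingaleM.super {P : Measure Ω} {Λ : MeasurableSpace (Ω × ℝ≥0)} {Z : Ω × ℝ≥0∞ → ℝ}
    (h : IsMartingaleM P Λ Z) : IsSupermartingaleM P Λ Z :=
  ⟨h.1, h.2.1, fun S T hS hT hST => (h.2.2 S T hS hT hST).symm.le⟩

section
variable {Λ : MeasurableSpace (Ω × ℝ≥0)} (hΛ : IsMeyer mΩ Λ)
  {P : Measure Ω} [IsProbabilityMeasure P] {Z : Ω × ℝ≥0∞ → ℝ} (hZ : IsSupermartingaleM P Λ Z)
  (hpos : ∀ p, 0 ≤ Z p)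
include hΛ hZ

theorem IsMeyer.setIntegral_le {S T : Ω → ℝ≥0∞} (hS : IsStoppingTimeM Λ S)
    (hT : IsStoppingTimeM Λ T) (hST : S ≤ T) {A : Set Ω} (hA : MeasurableSet[sigmaAtTime Λ S] A) :
    ∫ ω in A, EvalAt Z T ω ∂P ≤ ∫ ω in A, EvalAt Z S ω ∂P := by
  rw [← setIntegral_condExp (hΛ.sigmaAtTime_le hS) (hZ.2.1 T hT) hA]
  exact setIntegral_mono_ae integrable_condExp.integrableOn (hZ.2.1 S hS).integrableOn
    (hZ.2.2 S T hS hT hST)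

theorem IsMeyer.integral_le {S T : Ω → ℝ≥0∞} (hS : IsStoppingTimeM Λ S)
    (hT : IsStoppingTimeM Λ T) (hST : S ≤ T) :
    ∫ ω, EvalAt Z T ω ∂P ≤ ∫ ω, EvalAt Z S ω ∂P := by
  have := hΛ.setIntegral_le hZ hS hT hST (@MeasurableSet.univ _ (sigmaAtTime Λ S))
  simpa using this

include hpos

theorem IsMeyer.conv_mono {θ : ℕ → Ω → ℝ≥0∞} (hθ : ∀ n, IsStoppingTimeM Λ (θ n))
    (hm : ∀ n ω, θ n ω ≤ θ (n+1) ω) :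
    ∀ᵐ ω ∂P, ∃ L, Tendsto (fun n => Z (ω, θ n ω)) atTop (𝓝 L) := by
  have hmono : Monotone θ := monotone_nat_of_le_succ fun n ω => hm n ω
  let ℱ : Filtration ℕ mΩ :=
    { seq := fun n => sigmaAtTime Λ (θ n)
      mono' := fun i j hij => hΛ.sigmaAtTime_mono (hθ i) (hθ j) (hmono hij)
      le' := fun i => hΛ.sigmaAtTime_le (hθ i) }
  have hsup : Supermartingale (fun n => EvalAt Z (θ n)) ℱ P := by
    refine ⟨fun n => ?_, fun i j hij => hZ.2.2 _ _ (hθ i) (hθ j) (hmono hij), fun i => hZ.2.1 _ (hθ i)⟩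
    exact (evalAt_meas_sigma hZ.1).stronglyMeasurable
  have hsub := hsup.neg
  have hb : ∀ n, eLpNorm ((-fun n => EvalAt Z (θ n)) n) 1 P ≤
      ((∫ ω, EvalAt Z (θ 0) ω ∂P).toNNReal : ℝ≥0∞) := by
    intro n
    rw [Pi.neg_apply, eLpNorm_neg, eLpNorm_one_eq_lintegral_enorm]
    have h1 := ofReal_integral_norm_eq_lintegral_enorm (hZ.2.1 _ (hθ n))
    rw [← h1]
    refine ENNReal.ofReal_le_ofReal ?_
    have h2 : ∀ ω, ‖EvalAt Z (θ n) ω‖ = EvalAt Z (θ n) ω := fun ω => by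
      rw [Real.norm_eq_abs]; exact abs_of_nonneg (hpos _)
    simp only [h2]
    exact hΛ.integral_le hZ (hθ 0) (hθ n) (hmono (Nat.zero_le n))
  filter_upwards [hsub.exists_ae_tendsto_of_bdd hb] with ω ⟨c, hc⟩
  refine ⟨-c, ?_⟩
  have := hc.neg
  simpa [EvalAt] using this

theorem IsMeyer.prob_le {U : Ω → ℝ≥0∞} (hU : IsStoppingTimeM Λ U) {a : ℝ} (ha : 0 < a)
    (hUa : ∀ ω, U ω ≠ ∞ → a < Z (ω, U ω)) :
    P {ω | U ω < ∞} ≤ ENNReal.ofReal ((∫ ω, EvalAt Z (fun _ => 0) ω ∂P) / a) := by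
  have h0 := hΛ.const_st (0 : ℝ≥0∞)
  have h1 := hΛ.integral_le hZ h0 hU (fun ω => zero_le)
  have h2 := mul_meas_ge_le_integral_of_nonneg (Eventually.of_forall fun ω => hpos (ω, U ω))
    (hZ.2.1 U hU) a
  have h3 : P.real {ω | U ω < ∞} ≤ P.real {ω | a ≤ EvalAt Z U ω} :=
    measureReal_mono fun ω hω => (hUa ω (ne_of_lt hω)).le
  rw [← ofReal_measureReal]
  refine ENNReal.ofReal_le_ofReal ?_
  rw [le_div_iff₀ ha, mul_comm]
  exact (mul_le_mul_of_nonneg_left h3 ha.le).trans (h2.trans h1)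

theorem IsMeyer.bounded : ∀ᵐ ω ∂P, ∃ C : ℝ, ∀ t : ℝ≥0, Z (ω, t) ≤ C := by
  let B : ℕ → Set (Ω × ℝ≥0) := fun n => {p | (n:ℝ) + 1 < Z (p.1, (p.2 : ℝ≥0∞))}
  have hB : ∀ n, MeasurableSet[Λ] (B n) := fun n => hZ.1.1 measurableSet_Ioi
  let c := ∫ ω, EvalAt Z (fun _ => 0) ω ∂P
  have hc : 0 ≤ c := integral_nonneg fun ω => hpos _
  have h1 : ∀ n : ℕ, P (Prod.fst '' (B n)) ≤ ENNReal.ofReal ((c + 1) * (1 / ((n:ℝ)+1))) := by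
    intro n
    have hn : (0:ℝ) < (n:ℝ)+1 := by positivity
    obtain ⟨U, hU, hUB, hUP⟩ := hΛ.section_thm P (hB n) (ε := ENNReal.ofReal (1/((n:ℝ)+1)))
      (by simpa using hn)
    have h2 := hΛ.prob_le hZ hpos hU hn (fun ω h => by
      have := hUB ω h
      simp only [B, mem_ofPred_eq, ENNReal.coe_toNNReal h] at this
      exact this)
    have h3 : Prod.fst '' (B n) ⊆ {ω | U ω < ∞} ∪ (Prod.fst '' (B n) \ {ω | U ω < ∞}) := by
      rw [union_sdiff_self]; exact subset_union_right
    refine (measure_mono h3).trans ((measure_union_le _ _).trans ((add_le_add h2 hUP).trans ?_))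
    rw [← ENNReal.ofReal_add (by positivity) (by positivity)]
    refine ENNReal.ofReal_le_ofReal ?_
    rw [add_mul, mul_one_div, one_mul]
  have h2 : P (⋂ n, Prod.fst '' (B n)) = 0 := by
    have h3 : Tendsto (fun n : ℕ => ENNReal.ofReal ((c + 1) * (1 / ((n:ℝ)+1)))) atTop (𝓝 0) := by
      have := (tendsto_one_div_add_atTop_nhds_zero_nat (𝕜 := ℝ)).const_mul (c+1)
      rw [mul_zero] at this
      simpa using ENNReal.tendsto_ofReal this
    exact le_antisymm (ge_of_tendsto' h3 fun n => (measure_mono (iInter_subset _ n)).trans (h1 n)) zero_le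
  refine measure_mono_null ?_ h2
  intro ω hω
  rw [mem_iInter]
  intro n
  simp only [mem_compl_iff, mem_ofPred_eq, not_exists, not_forall, not_le] at hω
  obtain ⟨t, ht⟩ := hω ((n:ℝ)+1)
  exact ⟨(ω, t), ht, rfl⟩

theorem IsMeyer.left_aux {θ : ℕ → Ω → ℝ≥0∞} (hθ : ∀ n, IsStoppingTimeM Λ (θ n))
    (hm : ∀ n ω, θ n ω ≤ θ (n+1) ω) {δ : ℝ} (hδ : 0 < δ) :
    ∀ᵐ ω ∂P, ∀ n : ℕ, ∃ k ≥ n, ∀ t : ℝ≥0, θ k ω < t → (∃ j, (t : ℝ≥0∞) ≤ θ j ω) →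
      Z (ω, t) ≤ Z (ω, θ k ω) + δ := by
  have hmono : Monotone θ := monotone_nat_of_le_succ fun n ω => hm n ω
  let B : ℕ → Set (Ω × ℝ≥0) := fun k =>
    {p | θ k p.1 < p.2 ∧ (∃ j, (p.2 : ℝ≥0∞) ≤ θ j p.1) ∧ Z (p.1, θ k p.1) + δ < Z (p.1, (p.2:ℝ≥0∞))}
  have hB : ∀ k, MeasurableSet[Λ] (B k) := by
    intro k
    have hcl := hΛ.st_cl (hθ k)
    have e : B k = ({p | θ k p.1 < p.2} ∩ (⋃ j, {p : Ω × ℝ≥0 | θ j p.1 < p.2}ᶜ)) ∩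
        {p | Z ((psi (θ k) p).1, ((psi (θ k) p).2 : ℝ≥0∞)) + δ < Z (p.1, (p.2:ℝ≥0∞))} := by
      ext p
      simp only [B, mem_ofPred_eq, mem_inter_iff, mem_iUnion, mem_compl_iff, not_lt, and_assoc]
      refine and_congr_right fun h => and_congr_right fun _ => ?_
      rw [psi, if_pos h, ENNReal.coe_toNNReal (h.trans ENNReal.coe_lt_top).ne]
    rw [e]
    refine ((hΛ.meas_lt hcl).inter (MeasurableSet.iUnion fun j =>
      (hΛ.meas_lt (hΛ.st_cl (hθ j))).compl)).inter ?_
    refine measurableSet_lt (Measurable.add_const ?_ _) hZ.1.1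
    exact hZ.1.1.comp (hΛ.psi_meas hcl)
  have hp2 : ∀ i : ℕ, ((1/2:ℝ≥0∞))^i ≠ 0 := fun i => by simp
  choose U hU hUB hUP using fun k i => hΛ.section_thm P (hB k) (hp2 i)
  have hnext : ∀ k i, ∃ k', k < k' ∧ P {ω | U k i ω < ∞ ∧ θ k' ω < U k i ω} ≤ (1/2)^i := by
    intro k i
    have h1 : Tendsto (fun n => P {ω | U k i ω < ∞ ∧ θ n ω < U k i ω}) atTop (𝓝 0) := by
      have hempty : (⋂ n, {ω | U k i ω < ∞ ∧ θ n ω < U k i ω}) = ∅ := by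
        ext ω
        simp only [mem_iInter, mem_ofPred_eq, mem_empty_iff_false, iff_false, not_forall]
        by_cases h : U k i ω < ∞
        · obtain ⟨-, ⟨j, hj⟩, -⟩ := hUB k i ω h.ne
          refine ⟨j, ?_⟩
          simp only [ENNReal.coe_toNNReal h.ne] at hj
          exact fun h2 => absurd hj (not_le.2 h2.2)
        · exact ⟨0, fun h2 => h h2.1⟩
      rw [← measure_empty (μ := P), ← hempty]
      refine tendsto_measure_iInter_atTop ?_ ?_ ⟨0, measure_ne_top _ _⟩
      · intro n
        have hu := hΛ.st_measurable (hU k i)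
        exact ((measurableSet_lt hu measurable_const).inter
          (measurableSet_lt (hΛ.st_measurable (hθ n)) hu)).nullMeasurableSet
      · intro a b hab ω hω
        exact ⟨hω.1, (hmono hab ω).trans_lt hω.2⟩
    obtain ⟨k', h2, h3⟩ := ((h1.eventually (ge_mem_nhds (pos_iff_ne_zero.2 (hp2 i)))).and
      (eventually_gt_atTop k)).exists
    exact ⟨k', h3, h2⟩
  choose nx hnx1 hnx2 using hnext
  let kk : ℕ → ℕ := fun i => Nat.rec 0 (fun i k => nx k i) i
  have hkk : ∀ i, kk (i+1) = nx (kk i) i := fun i => rfl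
  have hkmono : StrictMono kk := strictMono_nat_of_lt_succ fun i => by rw [hkk]; exact hnx1 _ _
  -- interleaved sequence
  let V : ℕ → Ω → ℝ≥0∞ := fun n => if n % 2 = 0 then θ (kk (n/2)) else
    fun ω => min (max (U (kk (n/2)) (n/2) ω) (θ (kk (n/2)) ω)) (θ (kk (n/2+1)) ω)
  have hV0 : ∀ i, V (2*i) = θ (kk i) := by
    intro i; simp [V]
  have hV1 : ∀ i, V (2*i+1) = fun ω => min (max (U (kk i) i ω) (θ (kk i) ω)) (θ (kk (i+1)) ω) := by
    intro i
    have h1 : (2*i+1) % 2 = 1 := by omega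
    have h2 : (2*i+1)/2 = i := by omega
    simp [V, h1, h2]
  have hVst : ∀ n, IsStoppingTimeM Λ (V n) := by
    intro n
    rcases Nat.even_or_odd' n with ⟨i, rfl | rfl⟩
    · rw [hV0]; exact hθ _
    · rw [hV1]; exact min_st (max_st (hU _ _) (hθ _)) (hθ _)
  have hVm : ∀ n ω, V n ω ≤ V (n+1) ω := by
    intro n ω
    rcases Nat.even_or_odd' n with ⟨i, rfl | rfl⟩
    · rw [hV0, hV1]
      exact le_min (le_max_right _ _) (hmono (hkmono (Nat.lt_succ_self i)).le ω)
    · rw [show 2*i+1+1 = 2*(i+1) by ring, hV0, hV1]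
      exact min_le_right _ _
  have hconv := hΛ.conv_mono hZ hpos hVst hVm
  let bad : ℕ → Set Ω := fun i => (Prod.fst '' (B (kk i)) \ {ω | U (kk i) i ω < ∞}) ∪
    {ω | U (kk i) i ω < ∞ ∧ θ (kk (i+1)) ω < U (kk i) i ω}
  have hbad : ∑' i, P (bad i) ≠ ∞ := by
    have : ∑' i, P (bad i) ≤ ∑' i : ℕ, ((1/2:ℝ≥0∞)^i + (1/2)^i) := by
      refine ENNReal.tsum_le_tsum fun i => (measure_union_le _ _).trans ?_
      exact add_le_add (hUP _ _) (by rw [hkk]; exact hnx2 _ _)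
    refine (this.trans_lt ?_).ne
    rw [ENNReal.tsum_add]
    simp only [one_div, ENNReal.tsum_two_zpow_neg_add_one, ENNReal.tsum_geometric]
    simp
  filter_upwards [hconv, ae_eventually_notMem hbad] with ω ⟨L, hL⟩ hb n
  have h2 : Tendsto (fun i : ℕ => Z (ω, V (2*i+1) ω) - Z (ω, V (2*i) ω)) atTop (𝓝 (L - L)) := by
    refine Tendsto.sub (hL.comp ?_) (hL.comp ?_)
    · exact tendsto_atTop_mono (fun i => by simp only [id]; omega) tendsto_id
    · exact tendsto_atTop_mono (fun i => by simp only [id]; omega) tendsto_id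
  rw [sub_self] at h2
  obtain ⟨i, hi1, hi2, hi3⟩ := ((h2.eventually (gt_mem_nhds hδ)).and
    (hb.and (eventually_ge_atTop n))).exists
  refine ⟨kk i, hi3.trans hkmono.le_apply, fun t ht hj => ?_⟩
  by_contra hcon
  push Not at hcon
  have hmem : ω ∈ Prod.fst '' (B (kk i)) := ⟨(ω, t), ⟨ht, hj, hcon⟩, rfl⟩
  simp only [bad, mem_union, not_or, Set.mem_sdiff, not_and, not_not, mem_ofPred_eq, not_lt] at hi2
  have hfin : U (kk i) i ω < ∞ := not_le.1 (hi2.1 hmem)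
  have hle := hi2.2 hfin
  obtain ⟨hb1, -, hb3⟩ := hUB (kk i) i ω hfin.ne
  simp only [ENNReal.coe_toNNReal hfin.ne] at hb1 hb3
  have hVU : V (2*i+1) ω = U (kk i) i ω := by
    rw [hV1]
    simp only
    rw [max_eq_left hb1.le, min_eq_left hle]
  rw [hVU, hV0] at hi1
  linarith

end


theorem limsup_eq_of_seq {f : ℝ≥0 → ℝ} {F : Filter ℝ≥0} [F.NeBot] {u : ℕ → ℝ≥0} {L C : ℝ}
    (hf0 : ∀ t, 0 ≤ f t) (hfC : ∀ t, f t ≤ C) (hu : Tendsto u atTop F)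
    (hL : Tendsto (fun n => f (u n)) atTop (𝓝 L))
    (hub : ∀ δ : ℝ, 0 < δ → ∀ n, ∃ k ≥ n, ∀ᶠ t in F, f t ≤ f (u k) + δ) :
    limsup f F = L := by
  have hbd : F.IsBoundedUnder (· ≤ ·) f := isBoundedUnder_of ⟨C, hfC⟩
  have hbd2 : F.IsBoundedUnder (· ≥ ·) f := isBoundedUnder_of ⟨0, hf0⟩
  apply le_antisymm
  · refine le_of_forall_pos_le_add fun δ hδ => ?_
    have h1 : ∀ᶠ n in atTop, f (u n) < L + δ/2 := hL.eventually (gt_mem_nhds (by linarith))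
    obtain ⟨n, hn⟩ := eventually_atTop.1 h1
    obtain ⟨k, hk, hk2⟩ := hub (δ/2) (by linarith) n
    refine limsup_le_of_le hbd2.isCoboundedUnder_le ?_
    filter_upwards [hk2] with t ht
    have := hn k hk
    linarith
  · refine le_of_forall_pos_le_add fun δ hδ => ?_
    have h1 : ∀ᶠ n in atTop, L - δ < f (u n) := hL.eventually (lt_mem_nhds (by linarith))
    have h2 : ∃ᶠ t in F, L - δ ≤ f t :=
      hu.frequently (h1.mono fun n hn => hn.le).frequently
    have := le_limsup_of_frequently_le h2 hbd
    linarith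

section
variable {Λ : MeasurableSpace (Ω × ℝ≥0)} (hΛ : IsMeyer mΩ Λ)
  {P : Measure Ω} [IsProbabilityMeasure P] {Z : Ω × ℝ≥0∞ → ℝ} (hZ : IsSupermartingaleM P Λ Z)
  (hpos : ∀ p, 0 ≤ Z p)
include hΛ hZ hpos

theorem IsMeyer.left_lim {θ : ℕ → Ω → ℝ≥0∞} (hθ : ∀ n, IsStoppingTimeM Λ (θ n))
    (hm : ∀ n ω, θ n ω ≤ θ (n+1) ω) :
    ∀ᵐ ω ∂P, ∀ τ : ℝ≥0∞, (∀ n, θ n ω < τ) → Tendsto (fun n => θ n ω) atTop (𝓝 τ) →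
      Tendsto (fun n => Z (ω, θ n ω)) atTop (𝓝 (leftLimsup Z ω τ)) := by
  have h1 : ∀ᵐ ω ∂P, ∀ m : ℕ, ∀ n : ℕ, ∃ k ≥ n, ∀ t : ℝ≥0, θ k ω < t → (∃ j, (t : ℝ≥0∞) ≤ θ j ω) →
      Z (ω, t) ≤ Z (ω, θ k ω) + 1/((m:ℝ)+1) :=
    ae_all_iff.2 fun m => hΛ.left_aux hZ hpos hθ hm (by positivity)
  filter_upwards [h1, hΛ.bounded hZ hpos, hΛ.conv_mono hZ hpos hθ hm] with ω h1 ⟨C, hC⟩ ⟨L, hL⟩ τ hlt htend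
  have hfin : ∀ n, θ n ω ≠ ∞ := fun n => ((hlt n).trans_le le_top).ne
  let u : ℕ → ℝ≥0 := fun n => (θ n ω).toNNReal
  have hu : ∀ n, (u n : ℝ≥0∞) = θ n ω := fun n => ENNReal.coe_toNNReal (hfin n)
  have key : ∀ F : Filter ℝ≥0, F.NeBot → Tendsto u atTop F → (∀ n, ∀ᶠ t : ℝ≥0 in F, θ n ω < t) →
      (∀ᶠ t : ℝ≥0 in F, (t : ℝ≥0∞) < τ) → limsup (fun s : ℝ≥0 => Z (ω, (s : ℝ≥0∞))) F = L := by
    intro F hF huF hF1 hF2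
    refine limsup_eq_of_seq (fun t => hpos _) hC huF (by simpa only [hu] using hL) ?_
    intro δ hδ n
    obtain ⟨m, hm⟩ := exists_nat_one_div_lt hδ
    obtain ⟨k, hk, hk2⟩ := h1 m n
    refine ⟨k, hk, ?_⟩
    filter_upwards [hF1 k, hF2] with t ht1 ht2
    have := hk2 t ht1 (((htend.eventually (lt_mem_nhds ht2)).exists).imp fun j hj => hj.le)
    simp only [hu]
    linarith
  suffices hh : leftLimsup Z ω τ = L by rw [hh]; exact hL
  have h0 : τ ≠ 0 := (pos_of_gt (hlt 0)).ne'
  unfold leftLimsup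
  rw [if_neg h0]
  by_cases htop : τ = ∞
  · rw [if_pos htop]
    subst htop
    refine key _ inferInstance ?_ (fun n => ?_) (Eventually.of_forall fun t => ENNReal.coe_lt_top)
    · refine ENNReal.tendsto_coe_nhds_top.1 ?_
      simpa only [hu] using htend
    · filter_upwards [eventually_gt_atTop (u n)] with t ht
      rw [← hu]; exact_mod_cast ht
  · rw [if_neg htop]
    lift τ to ℝ≥0 using htop
    have hlt' : ∀ n, u n < τ := fun n => by have := hlt n; rw [← hu] at this; exact_mod_cast this
    simp only [ENNReal.toNNReal_coe]
    have hne : (𝓝[<] τ).NeBot := nhdsLT_neBot_of_exists_lt ⟨u 0, hlt' 0⟩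
    refine key _ hne ?_ (fun n => ?_) ?_
    · refine tendsto_nhdsWithin_iff.2 ⟨?_, Eventually.of_forall hlt'⟩
      refine ENNReal.tendsto_coe.1 ?_
      simpa only [hu] using htend
    · filter_upwards [Ioo_mem_nhdsLT (hlt' n)] with t ht
      rw [← hu]; exact_mod_cast ht.1
    · filter_upwards [self_mem_nhdsWithin] with t ht
      exact_mod_cast ht

end


section
variable {Λ : MeasurableSpace (Ω × ℝ≥0)} (hΛ : IsMeyer mΩ Λ)
include hΛ

theorem IsMeyer.add_cl {T : Ω → ℝ≥0∞} (hT : IsStoppingTimeCl (FplusLambda Λ) T) (c : ℝ≥0) :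
    IsStoppingTimeCl (FplusLambda Λ) (fun ω => T ω + c) := by
  intro t
  by_cases h : c ≤ t
  · refine hΛ.Fplus_mono (tsub_le_self : t - c ≤ t) _ ?_
    convert hT (t - c) using 1
    ext ω
    simp only [mem_ofPred_eq]
    rw [ENNReal.coe_sub, ENNReal.cancel_coe.le_tsub_iff_right (by exact_mod_cast h)]
  · convert @MeasurableSet.empty _ (FplusLambda Λ t) using 1
    ext ω
    simp only [mem_ofPred_eq, mem_empty_iff_false, iff_false, not_le]
    exact lt_of_lt_of_le (by exact_mod_cast not_le.1 h) le_add_self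

theorem IsMeyer.restrict_cl {T : Ω → ℝ≥0∞} (hT : IsStoppingTimeCl (FplusLambda Λ) T) {A : Set Ω}
    (hA : MeasurableSet[sigmaAtCl (FplusLambda Λ) T] A) :
    IsStoppingTimeCl (FplusLambda Λ) (restrictST T A) := by
  have key : ∀ t : ℝ≥0, MeasurableSet[FplusLambda Λ t] (A ∩ {ω | T ω ≤ (t : ℝ≥0∞)}) := by
    intro t
    induction A, hA using MeasurableSpace.generateFrom_induction with
    | hC A hA _ => exact hA t
    | empty => rw [empty_inter]; exact @MeasurableSet.empty _ (FplusLambda Λ t)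
    | compl A _ ih =>
      have : Aᶜ ∩ {ω | T ω ≤ (t : ℝ≥0∞)} = {ω | T ω ≤ (t : ℝ≥0∞)} \ (A ∩ {ω | T ω ≤ (t : ℝ≥0∞)}) := by
        ext ω; simp only [mem_inter_iff, mem_compl_iff, mem_ofPred_eq, Set.mem_sdiff]; tauto
      rw [this]
      exact MeasurableSet.diff (hT t) ih
    | iUnion f _ ih =>
      rw [iUnion_inter]
      exact MeasurableSet.iUnion ih
  intro t
  convert key t using 1
  ext ω
  simp only [restrictST, mem_ofPred_eq, mem_inter_iff]
  split_ifs with h <;> simp [h]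

variable {P : Measure Ω} [IsProbabilityMeasure P] {Z : Ω × ℝ≥0∞ → ℝ} (hZ : IsSupermartingaleM P Λ Z)
  (hpos : ∀ p, 0 ≤ Z p)
include hZ hpos

theorem IsMeyer.right_seq {T : Ω → ℝ≥0∞} (hT : IsStoppingTimeCl (FplusLambda Λ) T) :
    ∃ R : ℕ → Ω → ℝ≥0∞, (∀ n, IsStoppingTimeM Λ (R n)) ∧ (∀ n ω, T ω ≤ R n ω) ∧
      ∀ᵐ ω ∂P, T ω < ∞ → Tendsto (fun n => R n ω) atTop (𝓝 (T ω)) ∧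
        Tendsto (fun n => Z (ω, R n ω)) atTop (𝓝 (rightLimsup Z ω (T ω))) := by
  have hp2 : ∀ i : ℕ, ((1/2:ℝ≥0∞))^i ≠ 0 := fun i => by simp
  have hsum : ∑' i : ℕ, ((1/2:ℝ≥0∞))^i ≠ ∞ := by
    simp only [one_div, ENNReal.tsum_geometric]; simp
  let c : ℕ → ℝ≥0 := fun k => 1/((k:ℝ≥0)+1)
  have hc0 : ∀ k, 0 < c k := fun k => by positivity
  have hclim : Tendsto c atTop (𝓝 0) := tendsto_one_div_add_atTop_nhds_zero_nat
  let J : ℕ → Set (Ω × ℝ≥0) := fun k => {p | T p.1 < p.2 ∧ (p.2 : ℝ≥0∞) ≤ T p.1 + c k}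
  have hJ : ∀ k, MeasurableSet[Λ] (J k) := fun k => by
    convert (hΛ.meas_lt hT).inter (hΛ.meas_lt (hΛ.add_cl hT (c k))).compl using 1
    ext p
    simp only [J, mem_ofPred_eq, mem_inter_iff, mem_compl_iff, not_lt]
  have hZm : ∀ a : ℝ, MeasurableSet[Λ] {p : Ω × ℝ≥0 | a < Z (p.1, (p.2 : ℝ≥0∞))} :=
    fun a => hZ.1.1 measurableSet_Ioi
  choose U hU hUB hUP using fun (a : ℝ) k => hΛ.section_thm P ((hJ k).inter (hZm a)) (hp2 k)
  let E : ℝ → Set Ω := fun a => {ω | ∃ᶠ k in atTop, U a k ω < ∞}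
  -- if a sequence of times lies in the slots it converges to `T` from the right
  have hslot : ∀ ω, ∀ t : ℝ≥0, T ω < t → ∀ᶠ k in atTop, T ω + c k < t := by
    intro ω t ht
    have h1 : Tendsto (fun k => T ω + (c k : ℝ≥0∞)) atTop (𝓝 (T ω + (0:ℝ≥0))) :=
      tendsto_const_nhds.add (ENNReal.tendsto_coe.2 hclim)
    refine h1.eventually (gt_mem_nhds ?_)
    simpa using ht
  have hE : ∀ a, MeasurableSet[Λ] {p : Ω × ℝ≥0 | T p.1 < p.2 ∧ p.1 ∈ E a} := by
    intro a
    have : {p : Ω × ℝ≥0 | T p.1 < p.2 ∧ p.1 ∈ E a} = {p : Ω × ℝ≥0 | T p.1 < p.2} ∩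
        ⋂ n : ℕ, ⋃ k : ℕ, ⋃ _ : n ≤ k, {p : Ω × ℝ≥0 | U a k p.1 ≤ p.2} := by
      ext p
      simp only [mem_ofPred_eq, mem_inter_iff, mem_iInter, mem_iUnion, E, exists_prop]
      refine and_congr_right fun h => ?_
      rw [← frequently_atTop]
      constructor
      · intro hf
        refine (hf.and_eventually (hslot p.1 p.2 h)).mono fun k ⟨hk1, hk2⟩ => ?_
        obtain ⟨⟨-, hu⟩, -⟩ := hUB a k p.1 hk1.ne
        rw [ENNReal.coe_toNNReal hk1.ne] at hu
        exact hu.trans hk2.le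
      · exact fun hf => hf.mono fun k hk => hk.trans_lt ENNReal.coe_lt_top
    rw [this]
    exact (hΛ.meas_lt hT).inter (MeasurableSet.iInter fun n => MeasurableSet.iUnion fun k =>
      MeasurableSet.iUnion fun _ => hU a k)
  let B : ℕ → Set (Ω × ℝ≥0) := fun n => {p | p ∈ J n ∧
    ∀ j : ℕ, p.1 ∈ E (j * c n) → (j:ℝ) * c n - c n < Z (p.1, (p.2:ℝ≥0∞))}
  have hB : ∀ n, MeasurableSet[Λ] (B n) := by
    intro n
    have : B n = J n ∩ ⋂ j : ℕ, ({p : Ω × ℝ≥0 | T p.1 < p.2 ∧ p.1 ∈ E (j * c n)}ᶜ ∪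
        {p : Ω × ℝ≥0 | (j:ℝ) * c n - c n < Z (p.1, (p.2 : ℝ≥0∞))}) := by
      ext p
      simp only [B, mem_ofPred_eq, mem_inter_iff, mem_iInter, mem_union, mem_compl_iff]
      refine and_congr_right fun h => forall_congr' fun j => ?_
      have := h.1
      tauto
    rw [this]
    exact (hJ n).inter (MeasurableSet.iInter fun j => (hE _).compl.union (hZm _))
  choose R hR hRB hRP using fun n => hΛ.section_thm P (hB n) (hp2 n)
  refine ⟨R, hR, fun n ω => ?_, ?_⟩
  · by_cases h : R n ω = ∞
    · simp [h]
    · have := (hRB n ω h).1.1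
      simp only [ENNReal.coe_toNNReal h] at this
      exact this.le
  have hbc1 : ∀ᵐ ω ∂P, ∀ n j : ℕ, ∀ᶠ k in atTop,
      ω ∉ Prod.fst '' (J k ∩ {p : Ω × ℝ≥0 | (j:ℝ) * c n < Z (p.1, (p.2 : ℝ≥0∞))}) \ {ω | U (j * c n) k ω < ∞} := by
    refine ae_all_iff.2 fun n => ae_all_iff.2 fun j => ae_eventually_notMem ?_
    exact ((ENNReal.tsum_le_tsum fun k => hUP _ k).trans_lt hsum.lt_top).ne
  have hbc2 : ∀ᵐ ω ∂P, ∀ᶠ n in atTop, ω ∉ Prod.fst '' (B n) \ {ω | R n ω < ∞} := by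
    refine ae_eventually_notMem ?_
    exact ((ENNReal.tsum_le_tsum fun k => hRP k).trans_lt hsum.lt_top).ne
  filter_upwards [hbc1, hbc2, hΛ.bounded hZ hpos] with ω h1 h2 ⟨C, hC⟩ hTfin
  obtain ⟨τ, hτ⟩ : ∃ τ : ℝ≥0, T ω = τ := ⟨(T ω).toNNReal, (ENNReal.coe_toNNReal hTfin.ne).symm⟩
  set L := rightLimsup Z ω (T ω) with hLdef
  have hL : L = limsup (fun s : ℝ≥0 => Z (ω, (s : ℝ≥0∞))) (𝓝[>] τ) := by
    rw [hLdef, rightLimsup, if_neg hTfin.ne, hτ, ENNReal.toNNReal_coe]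
  have hbd : (𝓝[>] τ).IsBoundedUnder (· ≤ ·) (fun s : ℝ≥0 => Z (ω, (s : ℝ≥0∞))) :=
    isBoundedUnder_of ⟨C, hC⟩
  have hbd2 : (𝓝[>] τ).IsBoundedUnder (· ≥ ·) (fun s : ℝ≥0 => Z (ω, (s : ℝ≥0∞))) :=
    isBoundedUnder_of ⟨0, fun s => hpos _⟩
  -- frequently implies slot
  have hfreq : ∀ a, a < L → ∀ k, ∃ t : ℝ≥0, (ω, t) ∈ J k ∧ a < Z (ω, (t:ℝ≥0∞)) := by
    intro a ha k
    rw [hL] at ha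
    have hf := frequently_lt_of_lt_limsup hbd2.isCoboundedUnder_le ha
    have he : ∀ᶠ t in 𝓝[>] τ, t ∈ Ioo τ (τ + c k) := Ioo_mem_nhdsGT (lt_add_of_pos_right τ (hc0 k))
    obtain ⟨t, ht1, ht2⟩ := (hf.and_eventually he).exists
    refine ⟨t, ⟨?_, ?_⟩, ht1⟩
    · simp only [hτ]; exact_mod_cast ht2.1
    · simp only [hτ]; exact_mod_cast ht2.2.le
  have hEL : ∀ n j : ℕ, (j:ℝ) * c n < L → ω ∈ E (j * c n) := by
    intro n j hj
    refine Eventually.frequently ?_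
    filter_upwards [h1 n j] with k hk
    obtain ⟨t, ht1, ht2⟩ := hfreq _ hj k
    by_contra hcon
    exact hk ⟨⟨(ω, t), ⟨ht1, ht2⟩, rfl⟩, hcon⟩
  have hinto : ∀ k (t : ℝ≥0), (ω, t) ∈ J k → τ < t ∧ t ≤ τ + c k := by
    intro k t ht
    have h1 := ht.1
    have h2 := ht.2
    simp only [hτ] at h1 h2
    exact ⟨by exact_mod_cast h1, by exact_mod_cast h2⟩
  have hcτ : Tendsto (fun k => τ + c k) atTop (𝓝 τ) := by
    simpa using tendsto_const_nhds.add hclim (a := τ)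
  have hLE : ∀ a, ω ∈ E a → a ≤ L := by
    intro a ha
    rw [hL]
    refine le_limsup_of_frequently_le ?_ hbd
    intro hcon
    obtain ⟨v, hv1, hv2⟩ := (mem_nhdsGT_iff_exists_Ioc_subset).1 hcon
    obtain ⟨k, hk1, hk2⟩ := (ha.and_eventually (hcτ.eventually (gt_mem_nhds hv1))).exists
    obtain ⟨hu1, hu2⟩ := hUB a k ω hk1.ne
    have := hinto _ _ hu1
    exact hv2 ⟨this.1, this.2.trans hk2.le⟩ (le_of_lt hu2)
  have hhit : ∀ n, ω ∈ Prod.fst '' (B n) := by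
    intro n
    have hcn : (0:ℝ) < c n := hc0 n
    obtain ⟨t, ht1, ht2⟩ := hfreq (L - c n) (by linarith) n
    refine ⟨(ω, t), ⟨ht1, fun j hj => ?_⟩, rfl⟩
    have := hLE _ hj
    simp only
    linarith
  have hRfin : ∀ᶠ n in atTop, R n ω < ∞ := by
    filter_upwards [h2] with n hn
    by_contra hcon
    exact hn ⟨hhit n, hcon⟩
  have hRlim : Tendsto (fun n => (R n ω).toNNReal) atTop (𝓝[>] τ) := by
    refine tendsto_nhdsWithin_iff.2 ⟨?_, ?_⟩
    · refine tendsto_of_tendsto_of_tendsto_of_le_of_le' tendsto_const_nhds hcτ ?_ ?_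
      · filter_upwards [hRfin] with n hn
        exact (hinto n _ (hRB n ω hn.ne).1).1.le
      · filter_upwards [hRfin] with n hn
        exact (hinto n _ (hRB n ω hn.ne).1).2
    · filter_upwards [hRfin] with n hn
      exact (hinto n _ (hRB n ω hn.ne).1).1
  have hlow : ∀ᶠ n in atTop, L - 3 * c n ≤ Z (ω, R n ω) := by
    filter_upwards [hRfin] with n hn
    have hcn : (0:ℝ) < c n := hc0 n
    have h3 := (hRB n ω hn.ne).2
    simp only [ENNReal.coe_toNNReal hn.ne] at h3
    by_cases hsmall : L ≤ 3 * c n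
    · have := hpos (ω, R n ω); linarith
    · push Not at hsmall
      have hx : 3 < L / c n := by rw [lt_div_iff₀ hcn]; exact hsmall
      have hf1 := Nat.floor_le (a := L / c n - 1) (by linarith)
      have hf2 := Nat.lt_floor_add_one (L / c n - 1)
      set j := ⌊L / c n - 1⌋₊
      have e : L = L / c n * c n := by field_simp
      have hj1 : (j:ℝ) * c n < L := by
        rw [e]; exact mul_lt_mul_of_pos_right (by linarith) hcn
      have hj2 := h3 j (hEL n j hj1)
      have hj3 : L < ((j:ℝ) + 2) * c n := by
        rw [e]; exact mul_lt_mul_of_pos_right (by linarith) hcn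
      linarith
  refine ⟨?_, tendsto_order.2 ⟨fun a ha => ?_, fun a ha => ?_⟩⟩
  · have h3 : Tendsto (fun n => ((R n ω).toNNReal : ℝ≥0∞)) atTop (𝓝 (τ : ℝ≥0∞)) :=
      ENNReal.tendsto_coe.2 (hRlim.mono_right nhdsWithin_le_nhds)
    rw [hτ]
    refine h3.congr' ?_
    filter_upwards [hRfin] with n hn
    exact ENNReal.coe_toNNReal hn.ne
  · have h3 : Tendsto (fun n => L - 3 * (c n : ℝ)) atTop (𝓝 L) := by
      have := (NNReal.tendsto_coe.2 hclim).const_mul (3:ℝ)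
      simpa using this.const_sub L
    filter_upwards [hlow, h3.eventually (lt_mem_nhds ha)] with n hn1 hn2
    exact hn2.trans_le hn1
  · rw [hL] at ha
    have := hRlim.eventually (eventually_lt_of_limsup_lt ha hbd)
    filter_upwards [this, hRfin] with n hn1 hn2
    rwa [ENNReal.coe_toNNReal hn2.ne] at hn1

end


theorem predSF_section {G : ℝ≥0 → MeasurableSpace Ω} {B : Set (Ω × ℝ≥0)}
    (hB : MeasurableSet[predSF G] B) (q : ℝ≥0) : MeasurableSet[G q] {ω | (ω, q) ∈ B} := by
  have h : predSF G ≤ MeasurableSpace.map (fun ω : Ω => (ω, q)) (G q) := by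
    refine (genBy_le_iff _ _).2 ?_
    rintro Z ⟨-, hZ⟩ D hD
    exact hZ q hD
  exact h B hB

theorem predSF_rect {G : ℝ≥0 → MeasurableSpace Ω} (hG : Monotone G) {q : ℝ≥0} {A : Set Ω}
    (hA : MeasurableSet[G q] A) : MeasurableSet[predSF G] {p : Ω × ℝ≥0 | p.1 ∈ A ∧ q < p.2} := by
  let X : Ω × ℝ≥0 → ℝ := fun p => if p.1 ∈ A then max ((p.2:ℝ) - q) 0 else 0
  have hX : X ∈ {Z : Ω × ℝ≥0 → ℝ | (∀ ω, Continuous fun t => Z (ω, t)) ∧ Adapted' G Z} := by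
    constructor
    · intro ω
      by_cases h : ω ∈ A
      · simp only [X, h, if_true]
        fun_prop
      · simp only [X, h, if_false]
        fun_prop
    · intro t
      by_cases h : q ≤ t
      · exact @Measurable.ite _ _ _ _ (G t) _ _ _ (hG h _ hA)
          (@measurable_const _ _ _ (G t) (max ((t:ℝ) - q) 0)) (@measurable_const _ _ _ (G t) 0)
      · have : (fun ω => X (ω, t)) = fun _ => 0 := by
          ext ω
          simp only [X]
          have : (t:ℝ) - q ≤ 0 := by
            have := (not_le.1 h).le
            simpa using this
          rw [max_eq_right this, ite_self]
        rw [this]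
        exact @measurable_const _ _ _ (G t) _
  have h2 : Measurable[predSF G] X := measurable_genBy hX
  convert h2 (measurableSet_Ioi (a := (0:ℝ))) using 1
  ext p
  simp only [X, mem_ofPred_eq, mem_preimage, mem_Ioi]
  split_ifs with h
  · simp [h]
  · simp [h]

theorem predSF_graph {G : ℝ≥0 → MeasurableSpace Ω} (hG : Monotone G) {T : Ω → ℝ≥0∞}
    (hT : IsStoppingTimeM (predSF G) T) :
    MeasurableSet[predSF G] {p : Ω × ℝ≥0 | T p.1 = p.2} := by
  have h1 : MeasurableSet[predSF G] {p : Ω × ℝ≥0 | T p.1 < p.2} := by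
    have : {p : Ω × ℝ≥0 | T p.1 < p.2} = ⋃ n, {p : Ω × ℝ≥0 | p.1 ∈ {ω | T ω ≤ dq n} ∧ dq n < p.2} := by
      ext p
      simp only [mem_ofPred_eq, mem_iUnion]
      constructor
      · intro h
        obtain ⟨n, h1, h2⟩ := exists_dq_btwn h
        exact ⟨n, h1.le, by exact_mod_cast h2⟩
      · rintro ⟨n, h1, h2⟩
        exact h1.trans_lt (by exact_mod_cast h2)
    rw [this]
    refine @MeasurableSet.iUnion _ _ (predSF G) _ _ fun n => predSF_rect hG ?_
    exact predSF_section hT (dq n)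
  convert @MeasurableSet.diff _ (predSF G) _ _ hT h1 using 1
  ext p
  simp only [mem_ofPred_eq, Set.mem_sdiff, not_lt]
  exact ⟨fun h => ⟨h.le, h.ge⟩, fun h => le_antisymm h.1 h.2⟩

/-- Zero sets of nonnegative continuous adapted processes. -/
def ZeroSets (G : ℝ≥0 → MeasurableSpace Ω) : Set (Set (Ω × ℝ≥0)) :=
  {K | ∃ X : Ω × ℝ≥0 → ℝ, (∀ p, 0 ≤ X p) ∧ (∀ ω, Continuous fun t => X (ω, t)) ∧ Adapted' G X ∧
    K = {p | X p = 0}}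

theorem zeroSets_inter {G : ℝ≥0 → MeasurableSpace Ω} (K : ℕ → Set (Ω × ℝ≥0))
    (hK : ∀ n, K n ∈ ZeroSets G) : ⋂ n, K n ∈ ZeroSets G := by
  choose X hX0 hXc hXa hXK using hK
  let f : ℕ → Ω × ℝ≥0 → ℝ := fun n p => (1/2:ℝ)^n * min (X n p) 1
  have hf0 : ∀ n p, 0 ≤ f n p := fun n p =>
    mul_nonneg (by positivity) (le_min (hX0 n p) zero_le_one)
  have hfb : ∀ n p, f n p ≤ (1/2:ℝ)^n := fun n p => by
    have : (0:ℝ) < (1/2)^n := by positivity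
    calc f n p ≤ (1/2)^n * 1 := mul_le_mul_of_nonneg_left (min_le_right _ _) this.le
      _ = _ := mul_one _
  have hs : Summable fun n : ℕ => (1/2:ℝ)^n := summable_geometric_two
  have hsum : ∀ p, Summable fun n => f n p := fun p =>
    Summable.of_nonneg_of_le (fun n => hf0 n p) (fun n => hfb n p) hs
  refine ⟨fun p => ∑' n, f n p, fun p => tsum_nonneg fun n => hf0 n p, fun ω => ?_, fun t => ?_, ?_⟩
  · refine continuous_tsum (fun n => ?_) hs fun n t => ?_
    · exact continuous_const.mul ((hXc n ω).min continuous_const)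
    · rw [Real.norm_eq_abs, abs_of_nonneg (hf0 _ _)]; exact hfb _ _
  · refine @measurable_of_tendsto_metrizable _ _ (G t) _ _ _ _ (fun N ω => ∑ n ∈ Finset.range N, f n (ω, t)) _ ?_ ?_
    · intro N
      refine @Finset.measurable_sum _ _ _ _ _ _ (G t) _ _ fun n _ => ?_
      exact (Measurable.min (hXa n t) measurable_const).const_mul _
    · rw [tendsto_pi_nhds]
      exact fun ω => (hsum (ω, t)).hasSum.tendsto_sum_nat
  · ext p
    simp only [mem_iInter, mem_ofPred_eq, hXK]
    have h0 : (∑' n, f n p = 0) ↔ ∀ n, f n p = 0 := by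
      rw [← (hsum p).hasSum_iff, hasSum_zero_iff_of_nonneg (fun n => hf0 n p)]
      exact funext_iff
    rw [h0]
    refine forall_congr' fun n => ?_
    have : (0:ℝ) < (1/2)^n := by positivity
    simp only [f, mul_eq_zero, this.ne', false_or]
    constructor
    · intro h; rw [h]; simp
    · intro h
      rcases min_choice (X n p) 1 with h2 | h2
      · rw [← h2]; exact h
      · rw [h2] at h; norm_num at h

section
variable {Λ : MeasurableSpace (Ω × ℝ≥0)} (hΛ : IsMeyer mΩ Λ)
include hΛ

theorem IsMeyer.Fplus_le_m (t : ℝ≥0) : FplusLambda Λ t ≤ mΩ :=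
  (Fplus_le (lt_add_one t)).trans (hΛ.sigmaAt_le _)

theorem IsMeyer.pred_zero (P : Measure Ω) [IsProbabilityMeasure P] {T : Ω → ℝ≥0∞}
    (hT : IsStoppingTimeM (predSF (FplusLambda Λ)) T) {ε : ℝ≥0∞} (hε : ε ≠ 0) :
    ∃ X : Ω × ℝ≥0 → ℝ, (∀ p, 0 ≤ X p) ∧ (∀ ω, Continuous fun t => X (ω, t)) ∧
      Adapted' (FplusLambda Λ) X ∧ (∀ ω (t : ℝ≥0), X (ω, t) = 0 → T ω = t) ∧
      P {ω | T ω < ∞ ∧ X (ω, (T ω).toNNReal) ≠ 0} ≤ ε := by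
  have hTm : Measurable[mΩ] T := hΛ.cl_measurable fun q => predSF_section hT q
  let g : Ω → Ω × ℝ≥0 := fun ω => (ω, (T ω).toNNReal)
  have hg : @Measurable _ _ mΩ (mΩ.prod inferInstance) g := by
    refine @Measurable.prodMk _ mΩ _ _ mΩ _ _ _ measurable_id ?_
    exact hTm.ennreal_toNNReal
  have hF : MeasurableSet[mΩ] {ω | T ω < ∞} := hTm measurableSet_Iio
  let μ : @Measure (Ω × ℝ≥0) (mΩ.prod inferInstance) :=
    @Measure.map _ _ mΩ (mΩ.prod inferInstance) g (P.restrict {ω | T ω < ∞})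
  have hμ : @IsFiniteMeasure _ (mΩ.prod inferInstance) μ :=
    @Measure.isFiniteMeasure_map _ _ (mΩ.prod inferInstance) mΩ _ _ _
  have hmeas : ∀ X : Ω × ℝ≥0 → ℝ, (∀ ω, Continuous fun t => X (ω, t)) → Adapted' (FplusLambda Λ) X →
      @Measurable _ _ (mΩ.prod inferInstance) _ X := by
    intro X hc ha
    have := @measurable_uncurry_of_continuous_of_measurable Ω ℝ ℝ≥0 _ _ _ _ _ _ _ _ _ mΩ
      (fun t ω => X (ω, t)) hc (fun t => (ha t).mono (hΛ.Fplus_le_m t) le_rfl)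
    exact @Measurable.comp _ _ _ (mΩ.prod inferInstance) (@Prod.instMeasurableSpace _ _ _ mΩ) _ _ _ this
      (@measurable_swap _ _ mΩ _)
  have hK : ∀ K ∈ ZeroSets (FplusLambda Λ), MeasurableSet[mΩ.prod inferInstance] K := by
    rintro K ⟨X, -, hc, ha, rfl⟩
    exact hmeas X hc ha (measurableSet_singleton 0)
  obtain ⟨K, ⟨X, hX0, hXc, hXa, rfl⟩, hKB, hKμ⟩ := @inner_regular _ (mΩ.prod inferInstance) μ hμ
    {Z | (∀ ω, Continuous fun t => Z (ω, t)) ∧ Adapted' (FplusLambda Λ) Z}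
    (ZeroSets (FplusLambda Λ)) hK
    ⟨fun _ => 1, fun _ => zero_le_one, fun _ => continuous_const,
      fun t => @measurable_const _ _ _ (FplusLambda Λ t) _, by ext; simp⟩
    ⟨fun _ => 0, fun _ => le_rfl, fun _ => continuous_const,
      fun t => @measurable_const _ _ _ (FplusLambda Λ t) _, by ext; simp⟩
    (by
      rintro _ ⟨X, hX0, hXc, hXa, rfl⟩ _ ⟨Y, hY0, hYc, hYa, rfl⟩
      refine ⟨fun p => X p * Y p, fun p => mul_nonneg (hX0 p) (hY0 p), fun ω => (hXc ω).mul (hYc ω),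
        fun t => (hXa t).mul (hYa t), ?_⟩
      ext p; simp)
    zeroSets_inter
    (by
      rintro f ⟨hfc, hfa⟩ a
      refine ⟨fun p => max (f p - a) 0, fun p => le_max_right _ _, fun ω => ((hfc ω).sub continuous_const).max continuous_const,
        fun t => Measurable.max ((hfa t).sub_const a) measurable_const, ?_⟩
      ext p; simp)
    (by
      rintro f ⟨hfc, hfa⟩ a
      refine ⟨fun p => max (a - f p) 0, fun p => le_max_right _ _, fun ω => (continuous_const.sub (hfc ω)).max continuous_const,
        fun t => Measurable.max ((hfa t).const_sub a) measurable_const, ?_⟩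
      ext p; simp)
    _ (predSF_graph hΛ.Fplus_mono hT) ε hε
  refine ⟨X, hX0, hXc, hXa, fun ω t h => hKB h, ?_⟩
  have e : {ω | T ω < ∞ ∧ X (ω, (T ω).toNNReal) ≠ 0} ⊆
      g ⁻¹' ({p : Ω × ℝ≥0 | T p.1 = p.2} \ {p | X p = 0}) ∩ {ω | T ω < ∞} := by
    rintro ω ⟨h1, h2⟩
    exact ⟨⟨(ENNReal.coe_toNNReal h1.ne).symm, h2⟩, h1⟩
  refine (measure_mono e).trans ?_
  rw [← Measure.restrict_apply' hF]
  exact (@Measure.le_map_apply _ _ mΩ (mΩ.prod inferInstance) _ _ (@Measurable.aemeasurable _ _ mΩ (mΩ.prod inferInstance) _ _ hg) _).trans hKμ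

end


/-- First time a continuous function goes below a level. -/
def hit (f : ℝ≥0 → ℝ) (c : ℝ) : ℝ≥0∞ := ⨅ (t : ℝ≥0) (_ : f t ≤ c), (t : ℝ≥0∞)

theorem hit_le {f : ℝ≥0 → ℝ} {c : ℝ} {t : ℝ≥0} (h : f t ≤ c) : hit f c ≤ t := iInf₂_le t h

theorem hit_anti {f : ℝ≥0 → ℝ} {c d : ℝ} (h : c ≤ d) : hit f d ≤ hit f c :=
  le_iInf₂ fun _ ht => hit_le (ht.trans h)

theorem hit_le_iff {f : ℝ≥0 → ℝ} (hf : Continuous f) {c : ℝ} {t : ℝ≥0} :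
    hit f c ≤ t ↔ ∃ s ≤ t, f s ≤ c := by
  constructor
  · intro h
    by_contra hcon
    push Not at hcon
    obtain ⟨s, hs1, hs2⟩ := (isCompact_Icc (a := (0:ℝ≥0)) (b := t)).exists_isMinOn ⟨0, by simp⟩
      hf.continuousOn
    have h1 : c < f s := hcon s hs1.2
    have h2 : ∀ᶠ u in 𝓝 t, c < f u := hf.continuousAt.eventually (lt_mem_nhds (hcon t le_rfl))
    obtain ⟨v, hv1, hv2⟩ := (mem_nhdsGE_iff_exists_Ico_subset).1 (mem_nhdsWithin_of_mem_nhds h2 : {u | c < f u} ∈ 𝓝[≥] t)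
    have h3 : (v : ℝ≥0∞) ≤ hit f c := by
      refine le_iInf₂ fun u hu => ?_
      by_contra hlt
      have hlt : u < v := by exact_mod_cast not_le.1 hlt
      rcases le_total u t with hut | hut
      · exact absurd hu (not_le.2 (hcon u hut))
      · exact absurd hu (not_le.2 (hv2 ⟨hut, hlt⟩))
    have : (v : ℝ≥0∞) ≤ t := h3.trans h
    exact absurd hv1 (not_lt.2 (by exact_mod_cast this))
  · rintro ⟨s, hs, h⟩
    exact (hit_le h).trans (by exact_mod_cast hs)

theorem hit_le_iff_dq {f : ℝ≥0 → ℝ} (hf : Continuous f) {c : ℝ} {t : ℝ≥0} (ht : 0 < t) :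
    hit f c ≤ t ↔ ∀ n : ℕ, ∃ i, dq i < t ∧ f (dq i) < c + 1/((n:ℝ)+1) := by
  rw [hit_le_iff hf]
  constructor
  · rintro ⟨s, hs, h⟩ n
    have hn : (0:ℝ) < 1/((n:ℝ)+1) := by positivity
    have hcl : s ∈ closure (Iio t) := by
      rw [closure_Iio' (a := t) (⟨0, ht⟩ : (Iio t).Nonempty)]; exact hs
    have ho : IsOpen {u | f u < c + 1/((n:ℝ)+1)} := isOpen_lt hf continuous_const
    have hne : ({u | f u < c + 1/((n:ℝ)+1)} ∩ Iio t).Nonempty :=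
      mem_closure_iff.1 hcl _ ho (by simp only [mem_ofPred_eq]; linarith)
    obtain ⟨_, ⟨hi1, hi2⟩, ⟨i, rfl⟩⟩ := (TopologicalSpace.denseRange_denseSeq ℝ≥0).inter_open_nonempty _ (ho.inter isOpen_Iio) hne
    exact ⟨i, hi2, hi1⟩
  · intro h
    obtain ⟨s, hs1, hs2⟩ := (isCompact_Icc (a := (0:ℝ≥0)) (b := t)).exists_isMinOn ⟨0, by simp⟩
      hf.continuousOn
    refine ⟨s, hs1.2, le_of_forall_pos_le_add fun δ hδ => ?_⟩
    obtain ⟨n, hn⟩ := exists_nat_one_div_lt hδ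
    obtain ⟨i, hi1, hi2⟩ := h n
    have : f s ≤ f (dq i) := hs2 ⟨zero_le, hi1.le⟩
    linarith

section
variable {Λ : MeasurableSpace (Ω × ℝ≥0)} (hΛ : IsMeyer mΩ Λ)
include hΛ

theorem IsMeyer.rect_plus {q : ℝ≥0} {A : Set Ω} (hA : MeasurableSet[FplusLambda Λ q] A) :
    MeasurableSet[Λ] {p : Ω × ℝ≥0 | q < p.2 ∧ p.1 ∈ A} := by
  have : {p : Ω × ℝ≥0 | q < p.2 ∧ p.1 ∈ A} =
      ⋃ i, ⋃ _ : q < dq i, {p : Ω × ℝ≥0 | dq i ≤ p.2 ∧ p.1 ∈ A} := by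
    ext p
    simp only [mem_ofPred_eq, mem_iUnion]
    constructor
    · rintro ⟨h1, h2⟩
      obtain ⟨i, hi1, hi2⟩ := exists_dq_btwn (a := q) (b := p.2) (by exact_mod_cast h1)
      exact ⟨i, by exact_mod_cast hi1, by exact_mod_cast hi2.le, h2⟩
    · rintro ⟨i, h1, h2, h3⟩
      exact ⟨h1.trans_le h2, h3⟩
  rw [this]
  exact MeasurableSet.iUnion fun i => MeasurableSet.iUnion fun h => hΛ.rect (Fplus_le h _ hA)

theorem IsMeyer.hit_st {X : Ω × ℝ≥0 → ℝ} (hXc : ∀ ω, Continuous fun t => X (ω, t))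
    (hXa : Adapted' (FplusLambda Λ) X) {r : ℝ≥0} (hr : 0 < r) (c : ℝ) :
    IsStoppingTimeM Λ fun ω => max (hit (fun t => X (ω, t)) c) r := by
  unfold IsStoppingTimeM
  have : {p : Ω × ℝ≥0 | max (hit (fun t => X (p.1, t)) c) r ≤ (p.2 : ℝ≥0∞)} =
      Prod.snd ⁻¹' (Ici r) ∩ ⋂ n : ℕ, ⋃ i, {p : Ω × ℝ≥0 | dq i < p.2 ∧
        p.1 ∈ {ω | X (ω, dq i) < c + 1/((n:ℝ)+1)}} := by
    ext p
    simp only [mem_ofPred_eq, mem_inter_iff, mem_iInter, mem_iUnion, mem_preimage, mem_Ici, max_le_iff,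
      ENNReal.coe_le_coe]
    rw [and_comm]
    refine and_congr_right fun h => ?_
    exact hit_le_iff_dq (hXc p.1) (hr.trans_le h)
  rw [this]
  refine (hΛ.snd measurableSet_Ici).inter (MeasurableSet.iInter fun n => MeasurableSet.iUnion fun i =>
    hΛ.rect_plus ?_)
  exact hXa (dq i) measurableSet_Iio

theorem IsMeyer.announce0 (P : Measure Ω) [IsProbabilityMeasure P] {T : Ω → ℝ≥0∞}
    (hT : IsStoppingTimeM (predSF (FplusLambda Λ)) T) (hT0 : ∀ ω, T ω ≠ 0) {ε : ℝ≥0∞} (hε : ε ≠ 0) :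
    ∃ θ : ℕ → Ω → ℝ≥0∞, (∀ n, IsStoppingTimeM Λ (θ n)) ∧ (∀ n ω, θ n ω ≤ θ (n+1) ω) ∧
      P {ω | ¬ ((∀ n, θ n ω < T ω) ∧ Tendsto (fun n => θ n ω) atTop (𝓝 (T ω)))} ≤ ε := by
  have hε2 : ε / 2 ≠ 0 := by simpa using hε
  obtain ⟨X, hX0, hXc, hXa, hXz, hXP⟩ := hΛ.pred_zero P hT hε2
  have hTm : Measurable[mΩ] T := hΛ.cl_measurable fun q => predSF_section hT q
  obtain ⟨r, hr, hrP⟩ : ∃ r : ℝ≥0, 0 < r ∧ P {ω | T ω ≤ r} ≤ ε / 2 := by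
    have h1 : Tendsto (fun n : ℕ => P {ω | T ω ≤ (1/((n:ℝ≥0)+1) : ℝ≥0)}) atTop (𝓝 0) := by
      have hempty : (⋂ n : ℕ, {ω | T ω ≤ (1/((n:ℝ≥0)+1) : ℝ≥0)}) = ∅ := by
        ext ω
        simp only [mem_iInter, mem_ofPred_eq, mem_empty_iff_false, iff_false]
        intro h
        have h2 : Tendsto (fun n : ℕ => ((1/((n:ℝ≥0)+1) : ℝ≥0) : ℝ≥0∞)) atTop (𝓝 ((0:ℝ≥0):ℝ≥0∞)) :=
          ENNReal.tendsto_coe.2 tendsto_one_div_add_atTop_nhds_zero_nat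
        have := ge_of_tendsto' h2 h
        exact hT0 ω (by simpa using this)
      rw [← measure_empty (μ := P), ← hempty]
      refine tendsto_measure_iInter_atTop (fun n => (hTm measurableSet_Iic).nullMeasurableSet) ?_
        ⟨0, measure_ne_top _ _⟩
      intro a b hab ω hω
      have hω' : T ω ≤ (1/((b:ℝ≥0)+1) : ℝ≥0) := hω
      refine hω'.trans ?_
      rw [ENNReal.coe_le_coe]
      exact one_div_le_one_div_of_le (by positivity) (by gcongr)
    obtain ⟨n, hn⟩ := (h1.eventually (ge_mem_nhds (pos_iff_ne_zero.2 hε2))).exists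
    exact ⟨_, by positivity, hn⟩
  let ρ : ℕ → Ω → ℝ≥0∞ := fun m ω => max (hit (fun t => X (ω, t)) (1/((m:ℝ)+1))) r
  refine ⟨fun m ω => min (ρ m ω) ((m:ℝ≥0) + 1 : ℝ≥0), fun m => min_st (hΛ.hit_st hXc hXa hr _) (hΛ.const_st _), ?_, ?_⟩
  · intro n ω
    refine min_le_min (max_le_max (hit_anti ?_) le_rfl) ?_
    · exact one_div_le_one_div_of_le (by positivity) (by push_cast; linarith)
    · rw [ENNReal.coe_le_coe]; push_cast
      exact le_self_add
  have hsub : {ω | ¬ ((∀ n : ℕ, min (ρ n ω) ((n:ℝ≥0) + 1 : ℝ≥0) < T ω) ∧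
      Tendsto (fun n : ℕ => min (ρ n ω) ((n:ℝ≥0) + 1 : ℝ≥0)) atTop (𝓝 (T ω)))} ⊆
      {ω | T ω < ∞ ∧ X (ω, (T ω).toNNReal) ≠ 0} ∪ {ω | T ω ≤ r} := by
    intro ω hω
    by_contra hcon
    apply hω
    simp only [mem_union, mem_ofPred_eq, not_or, not_and, not_not, not_le] at hcon
    obtain ⟨hz, hrT⟩ := hcon
    have hlt : ∀ n : ℕ, min (ρ n ω) ((n:ℝ≥0) + 1 : ℝ≥0) < T ω := by
      intro n
      by_cases htop : T ω = ∞
      · rw [htop]; exact (min_le_right _ _).trans_lt ENNReal.coe_lt_top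
      · refine (min_le_left _ _).trans_lt (max_lt ?_ hrT)
        have h0 := hz (lt_top_iff_ne_top.2 htop)
        set τ := (T ω).toNNReal with hτ
        have hTτ : T ω = τ := (ENNReal.coe_toNNReal htop).symm
        have hτ0 : 0 < τ := by
          rw [pos_iff_ne_zero]; intro h; apply hT0 ω; rw [hTτ, h]; rfl
        have hcont : ∀ᶠ u in 𝓝[<] τ, X (ω, u) < 1/((n:ℝ)+1) :=
          nhdsWithin_le_nhds ((hXc ω).continuousAt.eventually (gt_mem_nhds (by simp only [h0]; positivity)))
        have hne : (𝓝[<] τ).NeBot := nhdsLT_neBot_of_exists_lt ⟨0, hτ0⟩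
        obtain ⟨u, hu1, hu2⟩ := (hcont.and self_mem_nhdsWithin).exists
        refine (hit_le hu1.le).trans_lt ?_
        rw [hTτ]; exact_mod_cast hu2
    refine ⟨hlt, tendsto_order.2 ⟨fun a ha => ?_, fun a ha => Eventually.of_forall fun n => (hlt n).trans ha⟩⟩
    obtain ⟨s, hs1, hs2⟩ := ENNReal.lt_iff_exists_nnreal_btwn.1 ha
    -- X is bounded below on [0,s]
    obtain ⟨v, hv1, hv2⟩ := (isCompact_Icc (a := (0:ℝ≥0)) (b := s)).exists_isMinOn ⟨0, by simp⟩
      (hXc ω).continuousOn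
    have hXv : 0 < X (ω, v) := by
      refine lt_of_le_of_ne (hX0 _) fun h => ?_
      have h2 := hXz ω v h.symm
      rw [h2] at hs2
      exact absurd hv1.2 (not_le.2 (by exact_mod_cast hs2))
    obtain ⟨n, hn⟩ := exists_nat_one_div_lt hXv
    obtain ⟨n', hn'⟩ := exists_nat_gt s
    filter_upwards [eventually_ge_atTop n, eventually_ge_atTop n'] with m hm hm'
    refine hs1.trans_le ?_
    refine le_min (le_trans ?_ (le_max_left _ _)) ?_
    · by_contra hcon
      obtain ⟨u, hu1, hu2⟩ := (hit_le_iff (hXc ω)).1 (not_le.1 hcon).le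
      have h3 : X (ω, v) ≤ X (ω, u) := hv2 ⟨zero_le, hu1⟩
      have h4 : 1/((m:ℝ)+1) ≤ 1/((n:ℝ)+1) := one_div_le_one_div_of_le (by positivity) (by gcongr)
      linarith
    · rw [ENNReal.coe_le_coe]
      have h5 : (n':ℝ≥0) ≤ m := by exact_mod_cast hm'
      exact (hn'.le.trans h5).trans le_self_add
  refine (measure_mono hsub).trans ((measure_union_le _ _).trans ?_)
  exact (add_le_add hXP hrP).trans (ENNReal.add_halves ε).le

theorem IsMeyer.approx (P : Measure Ω) [IsProbabilityMeasure P] {B : Set Ω}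
    (hB : MeasurableSet[sigmaInf Λ] B) {ε : ℝ≥0∞} (hε : ε ≠ 0) :
    ∃ (N : ℝ≥0) (A : Set Ω), MeasurableSet[sigmaAt Λ N] A ∧ P (A ∆ B) ≤ ε := by
  let C : Set (Set Ω) := ⋃ t : ℝ≥0, {A | MeasurableSet[sigmaAt Λ t] A}
  have hmem : ∀ A, A ∈ C ↔ ∃ t : ℝ≥0, MeasurableSet[sigmaAt Λ t] A := fun A => by simp [C]
  have hring : IsSetRing C := by
    refine ⟨(hmem _).2 ⟨0, @MeasurableSet.empty _ (sigmaAt Λ 0)⟩, ?_, ?_⟩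
    · intro s t hs ht
      obtain ⟨a, ha⟩ := (hmem _).1 hs
      obtain ⟨b, hb⟩ := (hmem _).1 ht
      exact (hmem _).2 ⟨max a b, @MeasurableSet.union _ (sigmaAt Λ (max a b)) _ _
        (hΛ.sigmaAt_mono (le_max_left a b) _ ha) (hΛ.sigmaAt_mono (le_max_right a b) _ hb)⟩
    · intro s t hs ht
      obtain ⟨a, ha⟩ := (hmem _).1 hs
      obtain ⟨b, hb⟩ := (hmem _).1 ht
      exact (hmem _).2 ⟨max a b, @MeasurableSet.diff _ (sigmaAt Λ (max a b)) _ _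
        (hΛ.sigmaAt_mono (le_max_left a b) _ ha) (hΛ.sigmaAt_mono (le_max_right a b) _ hb)⟩
  have hgen : sigmaInf Λ = MeasurableSpace.generateFrom C :=
    (MeasurableSpace.generateFrom_iUnion_measurableSet _).symm
  have hfin : @IsFiniteMeasure _ (sigmaInf Λ) (P.trim hΛ.sigmaInf_le) := isFiniteMeasure_trim _
  obtain ⟨A, hA, hAP⟩ := @exists_measure_symmDiff_lt_of_generateFrom_isSetRing _ (sigmaInf Λ)
    (P.trim hΛ.sigmaInf_le) hfin C hring
    ⟨{univ}, countable_singleton _, by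
      rw [singleton_subset_iff]; exact (hmem _).2 ⟨0, @MeasurableSet.univ _ (sigmaAt Λ 0)⟩, by simp⟩
    hgen B hB ε (pos_iff_ne_zero.2 hε)
  obtain ⟨N, hN⟩ := (hmem _).1 hA
  refine ⟨N, A, hN, ?_⟩
  rw [trim_measurableSet_eq] at hAP
  · exact hAP.le
  · exact @MeasurableSet.symmDiff _ (sigmaInf Λ) _ _ (sigmaAt_le_sigmaInf N _ hN) hB

end


section
variable {Λ : MeasurableSpace (Ω × ℝ≥0)} (hΛ : IsMeyer mΩ Λ)
include hΛ

theorem IsMeyer.sigmaPre_le {T : Ω → ℝ≥0∞} (hT : IsStoppingTimeCl (FplusLambda Λ) T) :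
    sigmaPre (FplusLambda Λ) T ≤ sigmaInf Λ := by
  have hle : ∀ t : ℝ≥0, FplusLambda Λ t ≤ sigmaInf Λ := fun t =>
    (Fplus_le (lt_add_one t)).trans (sigmaAt_le_sigmaInf _)
  refine MeasurableSpace.generateFrom_le ?_
  rintro A (hA | ⟨t, B, hB, rfl⟩)
  · exact hle 0 _ hA
  · refine @MeasurableSet.inter _ (sigmaInf Λ) _ _ (hle t _ hB) ?_
    have := @MeasurableSet.compl _ _ (sigmaInf Λ) (hle t _ (hT t))
    convert this using 1
    ext ω; simp

theorem IsMeyer.top_mem {T : Ω → ℝ≥0∞} (hT : IsStoppingTimeCl (FplusLambda Λ) T) :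
    MeasurableSet[sigmaInf Λ] {ω | T ω = ∞} := by
  have : {ω | T ω = ∞} = (⋃ n : ℕ, {ω | T ω ≤ (n : ℝ≥0)})ᶜ := by
    ext ω
    simp only [mem_ofPred_eq, mem_compl_iff, mem_iUnion, not_exists, not_le]
    constructor
    · intro h n; rw [h]; exact ENNReal.coe_lt_top
    · intro h
      refine ENNReal.eq_top_of_forall_nnreal_le fun r => ?_
      obtain ⟨n, hn⟩ := exists_nat_gt r
      exact (ENNReal.coe_le_coe.2 hn.le).trans (h n).le
  rw [this]
  refine @MeasurableSet.compl _ _ (sigmaInf Λ) (@MeasurableSet.iUnion _ _ (sigmaInf Λ) _ _ fun n => ?_)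
  exact ((Fplus_le (lt_add_one (n:ℝ≥0))).trans (sigmaAt_le_sigmaInf _)) _ (hT n)

theorem IsMeyer.announce (P : Measure Ω) [IsProbabilityMeasure P] {T : Ω → ℝ≥0∞} {Wm W Wp : Set Ω}
    (hdiv : IsDividedST Λ T Wm W Wp) {ε : ℝ≥0∞} (hε : ε ≠ 0) :
    ∃ θ : ℕ → Ω → ℝ≥0∞, (∀ n, IsStoppingTimeM Λ (θ n)) ∧ (∀ n ω, θ n ω ≤ θ (n+1) ω) ∧
      P {ω | ¬ ((ω ∈ Wm → (∀ n, θ n ω < T ω) ∧ Tendsto (fun n => θ n ω) atTop (𝓝 (T ω))) ∧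
        (ω ∉ Wm → T ω < ∞ → ∀ᶠ n in atTop, T ω < θ n ω) ∧
        (ω ∉ Wm → T ω = ∞ → ∀ᶠ n in atTop, θ n ω = ∞))} ≤ ε := by
  have hε3 : ε / 3 ≠ 0 := by simpa using hε
  have hT0 : ∀ ω, restrictST T Wm ω ≠ 0 := by
    intro ω h
    unfold restrictST at h
    split_ifs at h with hω
    · have : ω ∈ Wm ∩ {ω | T ω = 0} := ⟨hω, h⟩
      rw [hdiv.m_pos] at this
      exact this
    · exact absurd h ENNReal.top_ne_zero
  obtain ⟨θ, hθ, hm, hP1⟩ := hΛ.announce0 P hdiv.pred_m hT0 hε3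
  obtain ⟨N0, A, hA, hP2⟩ := hΛ.approx P (B := Wm ∩ {ω | T ω = ∞})
    (@MeasurableSet.inter _ (sigmaInf Λ) _ _ (hΛ.sigmaPre_le hdiv.stopping _ hdiv.mem_m)
      (hΛ.top_mem hdiv.stopping)) hε3
  have hTm : Measurable[mΩ] T := hΛ.cl_measurable hdiv.stopping
  obtain ⟨N, hN, hP3⟩ : ∃ N : ℝ≥0, N0 ≤ N ∧ P {ω | (N:ℝ≥0∞) < T ω ∧ T ω < ∞} ≤ ε / 3 := by
    have h1 : Tendsto (fun n : ℕ => P {ω | ((n:ℝ≥0):ℝ≥0∞) < T ω ∧ T ω < ∞}) atTop (𝓝 0) := by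
      have hempty : (⋂ n : ℕ, {ω | ((n:ℝ≥0):ℝ≥0∞) < T ω ∧ T ω < ∞}) = ∅ := by
        ext ω
        simp only [mem_iInter, mem_ofPred_eq, mem_empty_iff_false, iff_false]
        intro h
        have hfin := (h 0).2
        obtain ⟨n, hn⟩ := exists_nat_gt (T ω).toNNReal
        have := (h n).1
        rw [← ENNReal.coe_toNNReal hfin.ne] at this
        exact absurd hn (not_lt.2 (by exact_mod_cast this.le))
      rw [← measure_empty (μ := P), ← hempty]
      refine tendsto_measure_iInter_atTop (fun n =>
        ((hTm measurableSet_Ioi).inter (hTm measurableSet_Iio)).nullMeasurableSet) ?_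
        ⟨0, measure_ne_top _ _⟩
      intro a b hab ω hω
      refine ⟨lt_of_le_of_lt ?_ hω.1, hω.2⟩
      rw [ENNReal.coe_le_coe]
      exact_mod_cast hab
    obtain ⟨n0, hn0⟩ := exists_nat_ge N0
    obtain ⟨n, hn, hn2⟩ := ((h1.eventually (ge_mem_nhds (pos_iff_ne_zero.2 hε3))).and
      (eventually_ge_atTop n0)).exists
    exact ⟨n, hn0.trans (by exact_mod_cast hn2), hn⟩
  have hA' := hΛ.sigmaAt_mono hN _ hA
  refine ⟨fun n ω => if θ n ω < N ∨ ω ∈ A then θ n ω else ∞, fun n => ?_, fun n ω => ?_, ?_⟩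
  · unfold IsStoppingTimeM
    have h1 := hΛ.rect (@MeasurableSet.union _ (sigmaAt Λ N) _ _ (lt_sigmaAt (hΛ.st_cl (hθ n)) N) hA')
    convert MeasurableSet.inter (hθ n) ((hΛ.snd (measurableSet_Iio (a := N))).union h1) using 1
    ext p
    simp only [mem_ofPred_eq, mem_inter_iff, mem_union, mem_preimage, mem_Iio]
    split_ifs with h
    · refine ⟨fun h2 => ⟨h2, ?_⟩, fun h2 => h2.1⟩
      rcases lt_or_ge p.2 N with h3 | h3
      · exact Or.inl h3
      · exact Or.inr ⟨h3, h⟩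
    · simp only [top_le_iff, ENNReal.coe_ne_top, false_iff, not_and, not_or]
      refine fun h2 => ⟨fun h3 => h (Or.inl (h2.trans_lt (by exact_mod_cast h3))), fun _ => ?_⟩
      exact not_or.1 h
  · beta_reduce
    split_ifs with h1 h2 h2
    · exact hm n ω
    · exact le_top
    · exact absurd (h2.imp_left fun h => (hm n ω).trans_lt h) h1
    · exact le_rfl
  have hsub : {ω | ¬ ((ω ∈ Wm → (∀ n, (if θ n ω < N ∨ ω ∈ A then θ n ω else ∞) < T ω) ∧
        Tendsto (fun n => if θ n ω < N ∨ ω ∈ A then θ n ω else ∞) atTop (𝓝 (T ω))) ∧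
        (ω ∉ Wm → T ω < ∞ → ∀ᶠ n in atTop, T ω < if θ n ω < N ∨ ω ∈ A then θ n ω else ∞) ∧
        (ω ∉ Wm → T ω = ∞ → ∀ᶠ n in atTop, (if θ n ω < N ∨ ω ∈ A then θ n ω else ∞) = ∞))} ⊆
      {ω | ¬ ((∀ n, θ n ω < restrictST T Wm ω) ∧
        Tendsto (fun n => θ n ω) atTop (𝓝 (restrictST T Wm ω)))} ∪
      (A ∆ (Wm ∩ {ω | T ω = ∞}) ∪ {ω | (N:ℝ≥0∞) < T ω ∧ T ω < ∞}) := by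
    intro ω hω
    by_contra hcon
    apply hω
    rw [mem_union, mem_union, not_or, not_or] at hcon
    obtain ⟨h12, h3, h40⟩ := hcon
    obtain ⟨h1, h2⟩ := not_not.1 h12
    have h4 : (N:ℝ≥0∞) < T ω → ¬ T ω < ∞ := fun a b => h40 ⟨a, b⟩
    have h3' : ω ∈ A ↔ ω ∈ Wm ∧ T ω = ∞ := by
      simp only [mem_symmDiff, mem_inter_iff, mem_ofPred_eq] at h3
      tauto
    by_cases hWm : ω ∈ Wm
    · have e : restrictST T Wm ω = T ω := if_pos hWm
      rw [e] at h1 h2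
      have hcond : ∀ n, θ n ω < N ∨ ω ∈ A := by
        intro n
        by_cases htop : T ω = ∞
        · exact Or.inr (h3'.2 ⟨hWm, htop⟩)
        · refine Or.inl ((h1 n).trans_le ?_)
          by_contra hc
          exact h4 (not_le.1 hc) (lt_top_iff_ne_top.2 htop)
      simp only [hcond, if_true]
      exact ⟨fun _ => ⟨h1, h2⟩, fun h => absurd hWm h, fun h => absurd hWm h⟩
    · have e : restrictST T Wm ω = ∞ := if_neg hWm
      rw [e] at h1 h2
      have hA0 : ω ∉ A := fun h => hWm (h3'.1 h).1
      refine ⟨fun h => absurd h hWm, fun _ hfin => ?_, fun _ htop => ?_⟩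
      · filter_upwards [h2.eventually (lt_mem_nhds hfin)] with n hn
        split_ifs
        · exact hn
        · exact hfin
      · filter_upwards [h2.eventually (lt_mem_nhds (ENNReal.coe_lt_top (r := N)))] with n hn
        rw [if_neg]
        rintro (h | h)
        · exact lt_asymm h hn
        · exact hA0 h
  refine (measure_mono hsub).trans ((measure_union_le _ _).trans ((add_le_add hP1
    ((measure_union_le _ _).trans (add_le_add hP2 hP3))).trans ?_))
  rw [← add_assoc, ENNReal.add_thirds]

variable {P : Measure Ω} [IsProbabilityMeasure P] {Z : Ω × ℝ≥0∞ → ℝ} (hZ : IsSupermartingaleM P Λ Z)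
  (hpos : ∀ p, 0 ≤ Z p)
include hZ hpos

theorem IsMeyer.approx_seq {T : Ω → ℝ≥0∞} {Wm W Wp : Set Ω}
    (hdiv : IsDividedST Λ T Wm W Wp) {S : Ω → ℝ≥0∞} (hS : IsStoppingTimeM Λ S)
    (hST : ∀ ω, S ω ≤ T ω) (hSTm : ∀ ω ∈ Wm, S ω < T ω) {ε : ℝ≥0∞} (hε : ε ≠ 0) :
    ∃ σ : ℕ → Ω → ℝ≥0∞, (∀ n, IsStoppingTimeM Λ (σ n) ∧ S ≤ σ n) ∧
      P {ω | ¬ Tendsto (fun n => Z (ω, σ n ω)) atTop (𝓝 (divEval Z T Wm W Wp ω))} ≤ ε := by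
  obtain ⟨θ, hθ, hm, hP⟩ := hΛ.announce P hdiv hε
  obtain ⟨R, hR, hRT, hRlim⟩ := hΛ.right_seq hZ hpos (hΛ.restrict_cl hdiv.stopping hdiv.mem_p)
  have hle : ∀ A ω, T ω ≤ restrictST T A ω := by
    intro A ω; unfold restrictST; split_ifs
    · exact le_rfl
    · exact le_top
  refine ⟨fun n ω => min (max (θ n ω) (S ω)) (min (restrictST T W ω) (R n ω)), fun n =>
    ⟨min_st (max_st (hθ n) hS) (min_st hdiv.st_w (hR n)), fun ω => ?_⟩, ?_⟩
  · exact le_min (le_max_right _ _) (le_min ((hST ω).trans (hle _ _))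
      ((hST ω).trans ((hle _ _).trans (hRT n ω))))
  have hae : ∀ᵐ ω ∂P, ((ω ∈ Wm → (∀ n, θ n ω < T ω) ∧ Tendsto (fun n => θ n ω) atTop (𝓝 (T ω))) ∧
        (ω ∉ Wm → T ω < ∞ → ∀ᶠ n in atTop, T ω < θ n ω) ∧
        (ω ∉ Wm → T ω = ∞ → ∀ᶠ n in atTop, θ n ω = ∞)) →
      Tendsto (fun n => Z (ω, min (max (θ n ω) (S ω)) (min (restrictST T W ω) (R n ω)))) atTop
        (𝓝 (divEval Z T Wm W Wp ω)) := by
    filter_upwards [hΛ.left_lim hZ hpos hθ hm, hRlim] with ω hl hr ⟨h1, h2, h3⟩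
    by_cases hWm : ω ∈ Wm
    · have hW : ω ∉ W := fun h => by
        have : ω ∈ Wm ∩ W := ⟨hWm, h⟩
        rw [hdiv.disj_mw] at this; exact this
      have hWp : ω ∉ Wp := fun h => by
        have : ω ∈ Wm ∩ Wp := ⟨hWm, h⟩
        rw [hdiv.disj_mp] at this; exact this
      have e1 : restrictST T W ω = ∞ := if_neg hW
      have e2 : ∀ n, R n ω = ∞ := fun n => top_le_iff.1 (by
        have := hRT n ω
        rwa [restrictST, if_neg hWp] at this)
      have e3 : divEval Z T Wm W Wp ω = leftLimsup Z ω (T ω) := if_pos hWm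
      rw [e3]
      refine (hl _ (h1 hWm).1 (h1 hWm).2).congr' ?_
      filter_upwards [(h1 hWm).2.eventually (lt_mem_nhds (hSTm ω hWm))] with n hn
      rw [e1, e2, max_eq_left hn.le, min_self, min_eq_left le_top]
    · by_cases hW : ω ∈ W
      · have hWp : ω ∉ Wp := fun h => by
          have : ω ∈ W ∩ Wp := ⟨hW, h⟩
          rw [hdiv.disj_wp] at this; exact this
        have e1 : restrictST T W ω = T ω := if_pos hW
        have e2 : ∀ n, R n ω = ∞ := fun n => top_le_iff.1 (by
          have := hRT n ω
          rwa [restrictST, if_neg hWp] at this)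
        have e3 : divEval Z T Wm W Wp ω = Z (ω, T ω) := by
          unfold divEval; rw [if_neg hWm, if_pos hW]
        rw [e3]
        refine tendsto_const_nhds.congr' ?_
        have h4 : ∀ᶠ n in atTop, T ω ≤ θ n ω := by
          by_cases htop : T ω = ∞
          · filter_upwards [h3 hWm htop] with n hn
            rw [hn]; exact le_top
          · filter_upwards [h2 hWm (lt_top_iff_ne_top.2 htop)] with n hn
            exact hn.le
        filter_upwards [h4] with n hn
        rw [e1, e2, min_eq_left (le_top : T ω ≤ ∞), min_eq_right (hn.trans (le_max_left _ _))]
      · have hWp : ω ∈ Wp := by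
          have : ω ∈ Wm ∪ W ∪ Wp := by rw [hdiv.cover]; trivial
          rcases this with (h | h) | h
          · exact absurd h hWm
          · exact absurd h hW
          · exact h
        have hfin : T ω < ∞ := by
          refine lt_top_iff_ne_top.2 fun h => ?_
          have : ω ∈ Wp ∩ {ω | T ω = ∞} := ⟨hWp, h⟩
          rw [hdiv.p_fin] at this; exact this
        have e1 : restrictST T W ω = ∞ := if_neg hW
        have e0 : restrictST T Wp ω = T ω := if_pos hWp
        have e3 : divEval Z T Wm W Wp ω = rightLimsup Z ω (T ω) := by
          unfold divEval; rw [if_neg hWm, if_neg hW]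
        rw [e0] at hr
        rw [e3]
        refine ((hr hfin).2).congr' ?_
        obtain ⟨n0, hn0⟩ := (h2 hWm hfin).exists
        have hmono : Monotone fun n => θ n ω := monotone_nat_of_le_succ fun n => hm n ω
        filter_upwards [(hr hfin).1.eventually (gt_mem_nhds hn0), eventually_ge_atTop n0] with n hn hn2
        have h5 : R n ω ≤ θ n ω := hn.le.trans (hmono hn2)
        rw [e1, min_eq_right (le_top : R n ω ≤ ∞), min_eq_right (h5.trans (le_max_left _ _))]
  have h0 : P {ω | ¬ (((ω ∈ Wm → (∀ n, θ n ω < T ω) ∧ Tendsto (fun n => θ n ω) atTop (𝓝 (T ω))) ∧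
        (ω ∉ Wm → T ω < ∞ → ∀ᶠ n in atTop, T ω < θ n ω) ∧
        (ω ∉ Wm → T ω = ∞ → ∀ᶠ n in atTop, θ n ω = ∞)) →
      Tendsto (fun n => Z (ω, min (max (θ n ω) (S ω)) (min (restrictST T W ω) (R n ω)))) atTop
        (𝓝 (divEval Z T Wm W Wp ω)))} = 0 := ae_iff.1 hae
  refine le_trans (measure_mono ?_) ((measure_union_le _ _).trans ((add_le_add hP h0.le).trans (add_zero ε).le))
  intro ω hω
  by_contra hcon
  rw [mem_union, not_or] at hcon
  exact hω ((not_not.1 hcon.2) (not_not.1 hcon.1))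

end


/-- A function that can be approximated, up to sets of arbitrarily small measure, by convergent
sequences from a class of measurable functions is an a.e. limit of a sequence from the class. -/
theorem ae_limit_of_approx {ι : Type*} (P : Measure Ω) [IsProbabilityMeasure P] {C : ι → Prop}
    {F : ι → Ω → ℝ} (hF : ∀ i, C i → Measurable (F i)) {Y : Ω → ℝ}
    (h : ∀ ε : ℝ≥0∞, ε ≠ 0 → ∃ σ : ℕ → ι, (∀ n, C (σ n)) ∧
      P {ω | ¬ Tendsto (fun n => F (σ n) ω) atTop (𝓝 (Y ω))} ≤ ε) :
    ∃ σ : ℕ → ι, (∀ n, C (σ n)) ∧ ∀ᵐ ω ∂P, Tendsto (fun n => F (σ n) ω) atTop (𝓝 (Y ω)) := by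
  have key : ∀ k : ℕ, ∃ i, C i ∧ P {ω | (1:ℝ) / (k+1) < |F i ω - Y ω|} ≤ 2 * (2:ℝ≥0∞)⁻¹ ^ k := by
    intro k
    have hk : (2:ℝ≥0∞)⁻¹ ^ k ≠ 0 := pow_ne_zero _ (by simp)
    obtain ⟨σ, hσ, hP⟩ := h _ hk
    set D := {ω | ¬ Tendsto (fun n => F (σ n) ω) atTop (𝓝 (Y ω))} with hD
    have hkpos : (0:ℝ) < 1 / (k+1) := by positivity
    let A : ℕ → Set Ω := fun n => ⋃ i : ℕ, ⋃ j : ℕ,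
      {ω | n ≤ i ∧ n ≤ j ∧ (1:ℝ) / (k+1) < |F (σ i) ω - F (σ j) ω|}
    have hAm : ∀ n, MeasurableSet (A n) := by
      intro n
      refine MeasurableSet.iUnion fun i => MeasurableSet.iUnion fun j => ?_
      refine (MeasurableSet.const _).inter ((MeasurableSet.const _).inter ?_)
      exact measurableSet_lt measurable_const
        (continuous_abs.measurable.comp ((hF _ (hσ i)).sub (hF _ (hσ j))))
    have hanti : Antitone A := by
      intro a b hab ω hω
      simp only [A, mem_iUnion, mem_ofPred_eq] at hω ⊢
      obtain ⟨i, j, h1, h2, h3⟩ := hω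
      exact ⟨i, j, hab.trans h1, hab.trans h2, h3⟩
    have hsub : (⋂ n, A n) ⊆ D := by
      intro ω hω hlim
      have hc := hlim.cauchySeq
      obtain ⟨N, hN⟩ := Metric.cauchySeq_iff.1 hc _ hkpos
      have := mem_iInter.1 hω N
      simp only [A, mem_iUnion, mem_ofPred_eq] at this
      obtain ⟨i, j, h1, h2, h3⟩ := this
      have h4 := hN i h1 j h2
      rw [Real.dist_eq] at h4
      exact lt_asymm h3 h4
    have hlim := tendsto_measure_iInter_atTop (μ := P) (fun n => (hAm n).nullMeasurableSet) hanti
      ⟨0, measure_ne_top _ _⟩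
    have hfin : (2:ℝ≥0∞)⁻¹ ^ k ≠ ∞ := ENNReal.pow_ne_top (by simp)
    have hlt : P (⋂ n, A n) < (2:ℝ≥0∞)⁻¹ ^ k + (2:ℝ≥0∞)⁻¹ ^ k := by
      refine ((measure_mono hsub).trans hP).trans_lt (ENNReal.lt_add_right hfin hk)
    have hle : P (⋂ n, A n) ≤ (2:ℝ≥0∞)⁻¹ ^ k := (measure_mono hsub).trans hP
    -- bound the measure of `A n ∪ D`
    have hdiff : Tendsto (fun n => P (A n \ ⋂ m, A m)) atTop (𝓝 0) := by
      have e : (⋂ n, (A n \ ⋂ m, A m)) = ∅ := by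
        ext ω
        simp only [mem_iInter, Set.mem_sdiff, mem_empty_iff_false, iff_false]
        intro hh
        exact (hh 0).2 fun n => (hh n).1
      rw [← measure_empty (μ := P), ← e]
      refine tendsto_measure_iInter_atTop (fun n =>
        ((hAm n).diff (MeasurableSet.iInter hAm)).nullMeasurableSet) ?_ ⟨0, measure_ne_top _ _⟩
      exact fun a b hab => sdiff_subset_sdiff_left (hanti hab)
    obtain ⟨n, hn⟩ := (hdiff.eventually (ge_mem_nhds (pos_iff_ne_zero.2 hk))).exists
    refine ⟨σ n, hσ n, ?_⟩
    have hsub2 : {ω | (1:ℝ) / (k+1) < |F (σ n) ω - Y ω|} ⊆ D ∪ (A n \ ⋂ m, A m) := by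
      intro ω hω
      by_cases hDω : ω ∈ D
      · exact Or.inl hDω
      refine Or.inr ⟨?_, fun h => hDω (hsub h)⟩
      have hlimω : Tendsto (fun n => F (σ n) ω) atTop (𝓝 (Y ω)) := not_not.1 hDω
      have h2 : Tendsto (fun j => |F (σ n) ω - F (σ j) ω|) atTop (𝓝 |F (σ n) ω - Y ω|) :=
        (tendsto_const_nhds.sub hlimω).abs
      obtain ⟨j, hj, hj2⟩ := ((h2.eventually (lt_mem_nhds hω)).and (eventually_ge_atTop n)).exists
      simp only [A, mem_iUnion, mem_ofPred_eq]
      exact ⟨n, j, le_rfl, hj2, hj⟩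
    refine (measure_mono hsub2).trans ((measure_union_le _ _).trans ((add_le_add hP hn).trans ?_))
    rw [two_mul]
  choose σ hσ hP using key
  refine ⟨σ, hσ, ?_⟩
  have hsum : (∑' k, P {ω | (1:ℝ) / (k+1) < |F (σ k) ω - Y ω|}) ≠ ∞ := by
    refine ne_top_of_le_ne_top ?_ (ENNReal.tsum_le_tsum hP)
    rw [ENNReal.tsum_mul_left, ENNReal.tsum_geometric]
    refine ENNReal.mul_ne_top (by simp) ?_
    rw [ENNReal.one_sub_inv_two, inv_inv]
    simp
  filter_upwards [ae_eventually_notMem hsum] with ω hω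
  rw [tendsto_iff_dist_tendsto_zero]
  refine tendsto_of_tendsto_of_tendsto_of_le_of_le' tendsto_const_nhds
    tendsto_one_div_add_atTop_nhds_zero_nat (Eventually.of_forall fun n => dist_nonneg) ?_
  filter_upwards [hω] with n hn
  rw [Real.dist_eq]
  exact not_lt.1 hn

section
variable {Λ : MeasurableSpace (Ω × ℝ≥0)} (hΛ : IsMeyer mΩ Λ)
  {P : Measure Ω} [IsProbabilityMeasure P] {Z : Ω × ℝ≥0∞ → ℝ}
  (hpos : ∀ p, 0 ≤ Z p)
include hΛ hpos

theorem IsMeyer.ae_seq (hZ : IsSupermartingaleM P Λ Z) {T : Ω → ℝ≥0∞} {Wm W Wp : Set Ω}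
    (hdiv : IsDividedST Λ T Wm W Wp) {S : Ω → ℝ≥0∞} (hS : IsStoppingTimeM Λ S)
    (hST : ∀ ω, S ω ≤ T ω) (hSTm : ∀ ω ∈ Wm, S ω < T ω) :
    ∃ σ : ℕ → Ω → ℝ≥0∞, (∀ n, IsStoppingTimeM Λ (σ n) ∧ S ≤ σ n) ∧
      ∀ᵐ ω ∂P, Tendsto (fun n => EvalAt Z (σ n) ω) atTop (𝓝 (divEval Z T Wm W Wp ω)) :=
  ae_limit_of_approx P (C := fun R => IsStoppingTimeM Λ R ∧ S ≤ R) (F := fun R => EvalAt Z R)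
    (fun _ h => hΛ.evalAt_meas h.1 hZ.1)
    (fun _ hε => hΛ.approx_seq hZ hpos hdiv hS hST hSTm hε)

theorem IsMeyer.fatou (hZ : IsSupermartingaleM P Λ Z) {S : Ω → ℝ≥0∞} (hS : IsStoppingTimeM Λ S)
    {σ : ℕ → Ω → ℝ≥0∞} (hσ : ∀ n, IsStoppingTimeM Λ (σ n) ∧ S ≤ σ n) {Y : Ω → ℝ}
    (hlim : ∀ᵐ ω ∂P, Tendsto (fun n => EvalAt Z (σ n) ω) atTop (𝓝 (Y ω)))
    {A : Set Ω} (hA : MeasurableSet[sigmaAtTime Λ S] A) :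
    ∫⁻ ω in A, ENNReal.ofReal (Y ω) ∂P ≤ ENNReal.ofReal (∫ ω in A, EvalAt Z S ω ∂P) := by
  have h1 : ∫⁻ ω in A, ENNReal.ofReal (Y ω) ∂P =
      ∫⁻ ω in A, liminf (fun n => ENNReal.ofReal (EvalAt Z (σ n) ω)) atTop ∂P := by
    refine lintegral_congr_ae (ae_restrict_of_ae ?_)
    filter_upwards [hlim] with ω hω
    exact ((ENNReal.continuous_ofReal.tendsto _).comp hω).liminf_eq.symm
  rw [h1]
  refine (lintegral_liminf_le fun n =>
    (ENNReal.measurable_ofReal.comp (hΛ.evalAt_meas (hσ n).1 hZ.1))).trans ?_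
  refine liminf_le_of_le (by isBoundedDefault) fun b hb => ?_
  obtain ⟨n, hn⟩ := hb.exists
  refine hn.trans ?_
  change ∫⁻ ω in A, ENNReal.ofReal (EvalAt Z (σ n) ω) ∂P ≤ _
  rw [← ofReal_integral_eq_lintegral_ofReal (hZ.2.1 _ (hσ n).1).integrableOn
    (Eventually.of_forall fun ω => hpos _)]
  exact ENNReal.ofReal_le_ofReal (hΛ.setIntegral_le hZ hS (hσ n).1 (hσ n).2 hA)

theorem IsMeyer.lim_integrable (hZ : IsSupermartingaleM P Λ Z) {S : Ω → ℝ≥0∞}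
    (hS : IsStoppingTimeM Λ S)
    {σ : ℕ → Ω → ℝ≥0∞} (hσ : ∀ n, IsStoppingTimeM Λ (σ n) ∧ S ≤ σ n) {Y : Ω → ℝ}
    (hlim : ∀ᵐ ω ∂P, Tendsto (fun n => EvalAt Z (σ n) ω) atTop (𝓝 (Y ω))) :
    Integrable Y P ∧ 0 ≤ᵐ[P] Y := by
  have h0 : 0 ≤ᵐ[P] Y := by
    filter_upwards [hlim] with ω hω
    exact ge_of_tendsto' hω fun n => hpos _
  have hm : AEStronglyMeasurable Y P := aestronglyMeasurable_of_tendsto_ae atTop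
    (fun n => (hΛ.evalAt_meas (hσ n).1 hZ.1).aestronglyMeasurable) hlim
  refine ⟨⟨hm, ?_⟩, h0⟩
  rw [hasFiniteIntegral_iff_ofReal h0]
  have := hΛ.fatou hpos hZ hS hσ hlim (A := univ) (@MeasurableSet.univ _ (sigmaAtTime Λ S))
  rw [Measure.restrict_univ] at this
  exact this.trans_lt ENNReal.ofReal_lt_top

theorem IsMeyer.super_main (hZ : IsSupermartingaleM P Λ Z) {S : Ω → ℝ≥0∞}
    (hS : IsStoppingTimeM Λ S)
    {σ : ℕ → Ω → ℝ≥0∞} (hσ : ∀ n, IsStoppingTimeM Λ (σ n) ∧ S ≤ σ n) {Y : Ω → ℝ}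
    (hlim : ∀ᵐ ω ∂P, Tendsto (fun n => EvalAt Z (σ n) ω) atTop (𝓝 (Y ω))) :
    P[Y|sigmaAtTime Λ S] ≤ᵐ[P] EvalAt Z S := by
  obtain ⟨hYint, h0⟩ := hΛ.lim_integrable hpos hZ hS hσ hlim
  have hle := hΛ.sigmaAtTime_le hS
  have hsm : StronglyMeasurable[sigmaAtTime Λ S] (EvalAt Z S) :=
    (evalAt_meas_sigma hZ.1).stronglyMeasurable
  suffices P[Y|sigmaAtTime Λ S] ≤ᵐ[P.trim hle] EvalAt Z S from ae_le_of_ae_le_trim this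
  suffices 0 ≤ᵐ[P.trim hle] EvalAt Z S - P[Y|sigmaAtTime Λ S] by
    filter_upwards [this] with x hx
    rwa [← sub_nonneg]
  refine ae_nonneg_of_forall_setIntegral_nonneg
    (((hZ.2.1 S hS).sub integrable_condExp).trim _ (hsm.sub stronglyMeasurable_condExp))
      fun s hs _ => ?_
  rw [← setIntegral_trim _ (hsm.sub stronglyMeasurable_condExp) hs,
    integral_sub' (hZ.2.1 S hS).integrableOn integrable_condExp.integrableOn, sub_nonneg,
    setIntegral_condExp hle hYint hs]
  have hf := hΛ.fatou hpos hZ hS hσ hlim hs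
  rw [← ofReal_integral_eq_lintegral_ofReal hYint.integrableOn (ae_restrict_of_ae h0)] at hf
  exact (ENNReal.ofReal_le_ofReal_iff (integral_nonneg fun ω => hpos _)).1 hf

theorem IsMeyer.mart_main (hM : IsMartingaleM P Λ Z) {S : Ω → ℝ≥0∞}
    (hS : IsStoppingTimeM Λ S)
    {σ : ℕ → Ω → ℝ≥0∞} (hσ : ∀ n, IsStoppingTimeM Λ (σ n) ∧ S ≤ σ n) {Y : Ω → ℝ}
    (hlim : ∀ᵐ ω ∂P, Tendsto (fun n => EvalAt Z (σ n) ω) atTop (𝓝 (Y ω))) :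
    EvalAt Z S =ᵐ[P] P[Y|sigmaAtTime Λ S] := by
  obtain ⟨hYint, h0⟩ := hΛ.lim_integrable hpos hM.super hS hσ hlim
  have hle := hΛ.sigmaAtTime_le hS
  have hinf : IsStoppingTimeM Λ (fun _ => (∞ : ℝ≥0∞)) := hΛ.const_st ∞
  have hui := (hM.2.1 _ hinf).uniformIntegrable_condExp (fun n => hΛ.sigmaAtTime_le (hσ n).1)
  have heq : ∀ n, P[EvalAt Z (fun _ => (∞ : ℝ≥0∞))|sigmaAtTime Λ (σ n)] =ᵐ[P] EvalAt Z (σ n) :=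
    fun n => (hM.2.2 _ _ (hσ n).1 hinf (fun _ => le_top)).symm
  have hui2 : UnifIntegrable (fun n => EvalAt Z (σ n)) 1 P := hui.2.1.ae_eq heq
  have hL1 := tendsto_Lp_finite_of_tendsto_ae le_rfl ENNReal.one_ne_top
    (fun n => (hΛ.evalAt_meas (hσ n).1 hM.1).aestronglyMeasurable)
    (memLp_one_iff_integrable.2 hYint) hui2 hlim
  refine ae_eq_condExp_of_forall_setIntegral_eq hle hYint
    (fun s _ _ => (hM.2.1 S hS).integrableOn) (fun s hs _ => ?_)
    (evalAt_meas_sigma hM.1).stronglyMeasurable.aestronglyMeasurable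
  have hl := tendsto_setIntegral_of_L1' Y hYint.1
    (Eventually.of_forall fun n => hM.2.1 _ (hσ n).1) hL1 s
  refine tendsto_nhds_unique (tendsto_const_nhds.congr fun n => ?_) hl
  rw [← setIntegral_condExp hle (hM.2.1 _ (hσ n).1) hs]
  exact integral_congr_ae (ae_restrict_of_ae (hM.2.2 S _ hS (hσ n).1 (hσ n).2))

end

/-- Optional sampling at divided stopping times: for `σ ≥ S`, every
nonnegative `Λ`-martingale satisfies `M_S = E[M_σ | F^Λ_S]` and every nonnegative
`Λ`-supermartingale satisfies `Z_S ≥ E[Z_σ | F^Λ_S]`. -/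
theorem statement10 (P : Measure Ω) [IsProbabilityMeasure P] [hPc : P.IsComplete]
    (Λ : MeasurableSpace (Ω × ℝ≥0)) (hΛ : IsMeyer mΩ Λ) (hcomp : IsPCompleteM P Λ)
    (T : Ω → ℝ≥0∞) (Wm W Wp : Set Ω) (hdiv : IsDividedST Λ T Wm W Wp)
    (S : Ω → ℝ≥0∞) (hS : IsStoppingTimeM Λ S)
    (hST : ∀ ω, S ω ≤ T ω) (hSTm : ∀ ω ∈ Wm, S ω < T ω) :
    (∀ M : Ω × ℝ≥0∞ → ℝ, IsMartingaleM P Λ M → (∀ p, 0 ≤ M p) →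
      EvalAt M S =ᵐ[P] P[divEval M T Wm W Wp|sigmaAtTime Λ S]) ∧
    ∀ Z : Ω × ℝ≥0∞ → ℝ, IsSupermartingaleM P Λ Z → (∀ p, 0 ≤ Z p) →
      P[divEval Z T Wm W Wp|sigmaAtTime Λ S] ≤ᵐ[P] EvalAt Z S := by
  refine ⟨fun M hM hpos => ?_, fun Z hZ hpos => ?_⟩
  · obtain ⟨σ, hσ, hlim⟩ := hΛ.ae_seq hpos hM.super hdiv hS hST hSTm
    exact hΛ.mart_main hpos hM hS hσ hlim
  · obtain ⟨σ, hσ, hlim⟩ := hΛ.ae_seq hpos hZ hdiv hS hST hSTm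
    exact hΛ.super_main hpos hZ hS hσ hlim

end Meyer
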